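/- Let p_{Y1,Y2|X} be a discrete memoryless broadcast channel with finite alphabets, C(p_{Y_i|X}) > 0, and d_1, d_2 ∈ [0,1/2). If both marginal channels p_{Y1|X} and p_{Y2|X} are circularly symmetric, then κ* = min{κ ≥ 0 : 𝒞(BS-BC(d_1,d_2)) ⊆ κ·𝒞(p_{Y1,Y2|X})}, where κ* := min{κ ≥ 0 : 𝒞(BS-BC(d_1,d_2)) ⊆ κ·𝒞₁(p_{Y1,Y2|X})} if d_1 ≤ d_2 and κ* := min{κ ≥ 0 : 𝒞(BS-BC(d_1,d_2)) ⊆ κ·𝒞₂(p_{Y1,Y2|X})} if d_1 ≥ d_2. -/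

import Mathlib

open scoped BigOperators Classical
open Finset

noncomputable section

/-- `p` is a probability mass function on the finite type `α`. -/
def IsPMF {α : Type} [Fintype α] (p : α → ℝ) : Prop :=
  (∀ a, 0 ≤ p a) ∧ ∑ a, p a = 1

/-- Shannon entropy (base 2) of a pmf on a finite type. -/
def Hent {α : Type} [Fintype α] (p : α → ℝ) : ℝ :=
  -∑ a, p a * Real.logb 2 (p a)

/-- Mutual information `I(A;B)` of a joint pmf on `α × β` (base-2 logarithms). -/
def MI {α β : Type} [Fintype α] [Fintype β] (p : α × β → ℝ) : ℝ :=
  Hent (fun a => ∑ b, p (a, b)) + Hent (fun b => ∑ a, p (a, b)) - Hent p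

/-- Conditional mutual information `I(A;B|C)` of a joint pmf on `α × β × γ`. -/
def CMI {α β γ : Type} [Fintype α] [Fintype β] [Fintype γ] (p : α × β × γ → ℝ) : ℝ :=
  Hent (fun ac : α × γ => ∑ b, p (ac.1, b, ac.2))
    + Hent (fun bc : β × γ => ∑ a, p (a, bc.1, bc.2))
    - Hent p
    - Hent (fun c : γ => ∑ a, ∑ b, p (a, b, c))

/-- A channel: every input letter gives a pmf on outputs. -/
def IsChannel {X Z : Type} [Fintype Z] (W : X → Z → ℝ) : Prop :=
  ∀ x, IsPMF (W x)

/-- Marginal channel to receiver 1 of a broadcast channel. -/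
def margW1 {X Y1 Y2 : Type} [Fintype Y2] (W : X → Y1 × Y2 → ℝ) : X → Y1 → ℝ :=
  fun x y1 => ∑ y2, W x (y1, y2)

/-- Marginal channel to receiver 2 of a broadcast channel. -/
def margW2 {X Y1 Y2 : Type} [Fintype Y1] (W : X → Y1 × Y2 → ℝ) : X → Y2 → ℝ :=
  fun x y2 => ∑ y1, W x (y1, y2)

/-- Memoryless `n`-fold extension of a broadcast channel. -/
def nFold {X Y1 Y2 : Type} (W : X → Y1 × Y2 → ℝ) (n : ℕ)
    (x : Fin n → X) (y : (Fin n → Y1) × (Fin n → Y2)) : ℝ :=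
  ∏ t, W (x t) (y.1 t, y.2 t)

section Channel

variable {X Y1 Y2 : Type} [Fintype Y1] [Fintype Y2]

/-- Average error probability; message `M2` known at receiver 1. -/
def errP1 (W : X → Y1 × Y2 → ℝ) (n k1 k2 : ℕ) (f : Fin k1 × Fin k2 → Fin n → X)
    (g1 : (Fin n → Y1) × Fin k2 → Fin k1) (g2 : (Fin n → Y2) → Fin k2) : ℝ :=
  (1 : ℝ) / ((k1 : ℝ) * (k2 : ℝ)) *
    ∑ m : Fin k1 × Fin k2, ∑ y : (Fin n → Y1) × (Fin n → Y2),
      nFold W n (f m) y * (if g1 (y.1, m.2) = m.1 ∧ g2 y.2 = m.2 then 0 else 1)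

/-- Average error probability; message `M1` known at receiver 2. -/
def errP2 (W : X → Y1 × Y2 → ℝ) (n k1 k2 : ℕ) (f : Fin k1 × Fin k2 → Fin n → X)
    (g1 : (Fin n → Y1) → Fin k1) (g2 : (Fin n → Y2) × Fin k1 → Fin k2) : ℝ :=
  (1 : ℝ) / ((k1 : ℝ) * (k2 : ℝ)) *
    ∑ m : Fin k1 × Fin k2, ∑ y : (Fin n → Y1) × (Fin n → Y2),
      nFold W n (f m) y * (if g1 y.1 = m.1 ∧ g2 (y.2, m.1) = m.2 then 0 else 1)

/-- Average error probability; no receiver side information. -/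
def errP0 (W : X → Y1 × Y2 → ℝ) (n k1 k2 : ℕ) (f : Fin k1 × Fin k2 → Fin n → X)
    (g1 : (Fin n → Y1) → Fin k1) (g2 : (Fin n → Y2) → Fin k2) : ℝ :=
  (1 : ℝ) / ((k1 : ℝ) * (k2 : ℝ)) *
    ∑ m : Fin k1 × Fin k2, ∑ y : (Fin n → Y1) × (Fin n → Y2),
      nFold W n (f m) y * (if g1 y.1 = m.1 ∧ g2 y.2 = m.2 then 0 else 1)

/-- Achievability of a rate pair with `M2` available at receiver 1. -/
def Ach1 (W : X → Y1 × Y2 → ℝ) (R : ℝ × ℝ) : Prop :=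
  0 ≤ R.1 ∧ 0 ≤ R.2 ∧ ∀ ε : ℝ, 0 < ε →
    ∃ (n k1 k2 : ℕ), 0 < n ∧ 0 < k1 ∧ 0 < k2 ∧
      ∃ (f : Fin k1 × Fin k2 → Fin n → X) (g1 : (Fin n → Y1) × Fin k2 → Fin k1)
        (g2 : (Fin n → Y2) → Fin k2),
        R.1 ≤ Real.logb 2 (k1 : ℝ) / (n : ℝ) ∧ R.2 ≤ Real.logb 2 (k2 : ℝ) / (n : ℝ) ∧
        errP1 W n k1 k2 f g1 g2 ≤ ε

/-- Achievability of a rate pair with `M1` available at receiver 2. -/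
def Ach2 (W : X → Y1 × Y2 → ℝ) (R : ℝ × ℝ) : Prop :=
  0 ≤ R.1 ∧ 0 ≤ R.2 ∧ ∀ ε : ℝ, 0 < ε →
    ∃ (n k1 k2 : ℕ), 0 < n ∧ 0 < k1 ∧ 0 < k2 ∧
      ∃ (f : Fin k1 × Fin k2 → Fin n → X) (g1 : (Fin n → Y1) → Fin k1)
        (g2 : (Fin n → Y2) × Fin k1 → Fin k2),
        R.1 ≤ Real.logb 2 (k1 : ℝ) / (n : ℝ) ∧ R.2 ≤ Real.logb 2 (k2 : ℝ) / (n : ℝ) ∧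
        errP2 W n k1 k2 f g1 g2 ≤ ε

/-- Achievability of a rate pair with no receiver side information. -/
def Ach0 (W : X → Y1 × Y2 → ℝ) (R : ℝ × ℝ) : Prop :=
  0 ≤ R.1 ∧ 0 ≤ R.2 ∧ ∀ ε : ℝ, 0 < ε →
    ∃ (n k1 k2 : ℕ), 0 < n ∧ 0 < k1 ∧ 0 < k2 ∧
      ∃ (f : Fin k1 × Fin k2 → Fin n → X) (g1 : (Fin n → Y1) → Fin k1)
        (g2 : (Fin n → Y2) → Fin k2),
        R.1 ≤ Real.logb 2 (k1 : ℝ) / (n : ℝ) ∧ R.2 ≤ Real.logb 2 (k2 : ℝ) / (n : ℝ) ∧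
        errP0 W n k1 k2 f g1 g2 ≤ ε

/-- Capacity region `𝒞₁`: side information `M2` at receiver 1. -/
def Cap1 (W : X → Y1 × Y2 → ℝ) : Set (ℝ × ℝ) := closure {R | Ach1 W R}

/-- Capacity region `𝒞₂`: side information `M1` at receiver 2. -/
def Cap2 (W : X → Y1 × Y2 → ℝ) : Set (ℝ × ℝ) := closure {R | Ach2 W R}

/-- Private-message capacity region `𝒞`. -/
def Cap (W : X → Y1 × Y2 → ℝ) : Set (ℝ × ℝ) := closure {R | Ach0 W R}

end Channel

/-- `κ·𝒜` for a set of rate pairs. -/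
def scaleSet (κ : ℝ) (A : Set (ℝ × ℝ)) : Set (ℝ × ℝ) :=
  (fun R : ℝ × ℝ => (κ * R.1, κ * R.2)) '' A

/-- Binary entropy function (base 2). -/
def Hb (x : ℝ) : ℝ := -(x * Real.logb 2 x) - (1 - x) * Real.logb 2 (1 - x)

/-- Binary convolution `a*b = a(1-b)+(1-a)b`. -/
def bconv (a b : ℝ) : ℝ := a * (1 - b) + (1 - a) * b

/-- The region `𝒞(BS-BC(d₁,d₂))`. -/
def CBSBC (d1 d2 : ℝ) : Set (ℝ × ℝ) :=
  {R | 0 ≤ R.1 ∧ 0 ≤ R.2 ∧ ∃ α ∈ Set.Icc (0:ℝ) (1/2),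
    R.1 ≤ Hb (bconv α d1) - Hb d1 ∧ R.2 ≤ 1 - Hb (bconv α d2)}

/-- The region `𝒞(BE-BC(ε₁,ε₂))`. -/
def CBEBC (e1 e2 : ℝ) : Set (ℝ × ℝ) :=
  {R | 0 ≤ R.1 ∧ 0 ≤ R.2 ∧ ∃ β ∈ Set.Icc (0:ℝ) 1,
    R.1 ≤ β * (1 - e1) ∧ R.2 ≤ (1 - β) * (1 - e2)}

/-- 1-norm distance between two functions on a finite type. -/
def l1dist {α : Type} [Fintype α] (p q : α → ℝ) : ℝ := ∑ a, |p a - q a|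

/-- Capacity `C(p_{Y|X}) = max_{p_X} I(X;Y)` of a point-to-point channel. -/
def Cmarg {X Y : Type} [Fintype X] [Fintype Y] (Wm : X → Y → ℝ) : ℝ :=
  sSup {r | ∃ pX : X → ℝ, IsPMF pX ∧ r = MI (fun a : X × Y => pX a.1 * Wm a.1 a.2)}

/-- A point-to-point channel with input alphabet `{0,…,M−1}` is circularly
symmetric if there is a bijection `μ` of the output alphabet with `μ^M = id`
and `K(μ^x(y)|x) = K(y|0)` for all `x, y`. -/
def CircSym {M : ℕ} [NeZero M] {Y : Type} (K : Fin M → Y → ℝ) : Prop :=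
  ∃ μ : Equiv.Perm Y, (∀ y, (⇑μ)^[M] y = y) ∧
    ∀ (x : Fin M) (y : Y), K x ((⇑μ)^[(x : ℕ)] y) = K 0 y

/-! ### Averages over codebooks -/

theorem expect_resample {ι β : Type} [Fintype ι] [DecidableEq ι] [Fintype β] [Nonempty β]
    (m : ι) (G : (ι → β) → ℝ) :
    𝔼 c, G c = 𝔼 c : ι → β, 𝔼 a : β, G (Function.update c m a) := by
  have h1 : 𝔼 c : ι → β, G c = 𝔼 c : ι → β, 𝔼 a : β, G c := by
    refine Finset.expect_congr rfl fun c _ => ?_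
    rw [Fintype.expect_const]
  rw [h1, ← Finset.expect_product' univ univ (fun c (_ : β) => G c),
    ← Finset.expect_product' univ univ (fun c (a : β) => G (Function.update c m a))]
  refine Finset.expect_nbij' (fun p => (Function.update p.1 m p.2, p.1 m))
    (fun p => (Function.update p.1 m p.2, p.1 m)) ?_ ?_ ?_ ?_ ?_ <;> simp

theorem expect_coord {ι β : Type} [Fintype ι] [DecidableEq ι] [Fintype β] [Nonempty β]
    (m : ι) (H : β → ℝ) : 𝔼 c : ι → β, H (c m) = 𝔼 a : β, H a := by
  rw [expect_resample m]
  simp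

/-! ### Marginals of product distributions -/

theorem sum_pi_prod_one {ι Y : Type} [Fintype ι] [DecidableEq ι] [Fintype Y] (p : ι → Y → ℝ)
    (hp : ∀ i, ∑ y, p i y = 1) : ∑ y : ι → Y, ∏ i, p i (y i) = 1 := by
  have := (Finset.prod_univ_sum (fun _ : ι => (univ : Finset Y)) p).symm
  rw [Fintype.piFinset_univ] at this
  rw [this]; simp [hp]

theorem sum_pi_marginal {ι κ Y : Type} [Fintype ι] [Fintype κ] [Fintype Y]
    [DecidableEq ι] [DecidableEq κ]
    (p : ι → Y → ℝ) (hp : ∀ i, ∑ y, p i y = 1) (e : κ → ι) (he : Function.Injective e)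
    (G : (κ → Y) → ℝ) :
    ∑ y : ι → Y, (∏ i, p i (y i)) * G (fun k => y (e k))
      = ∑ z : κ → Y, (∏ k, p (e k) (z k)) * G z := by
  obtain ⟨r, hr⟩ : ∃ r : ι → Prop, ∀ i, r i ↔ ∃ k, e k = i := ⟨_, fun _ => Iff.rfl⟩
  have hrk : ∀ k, r (e k) := fun k => (hr _).2 ⟨k, rfl⟩
  let O : κ ≃ {i // r i} := Equiv.ofBijective (fun k => ⟨e k, hrk k⟩)
    ⟨fun a b h => he (Subtype.ext_iff.mp h), fun i => by
      obtain ⟨k, hk⟩ := (hr _).1 i.2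
      exact ⟨k, Subtype.ext hk⟩⟩
  have hO : ∀ k, O k = ⟨e k, hrk k⟩ := fun k => rfl
  let E := Equiv.piEquivPiSubtypeProd r (fun _ => Y)
  rw [← E.symm.sum_comp, Fintype.sum_prod_type]
  have h2 : ∀ (a : {i // r i} → Y) (b : {i // ¬ r i} → Y),
      (∏ i, p i (E.symm (a, b) i)) * G (fun k => E.symm (a, b) (e k))
      = ((∏ k, p (e k) (a (O k))) * G (fun k => a (O k))) *
        ∏ i : {i // ¬ r i}, p i.1 (b i) := by
    intro a b
    have h3 : ∀ i : {i // r i}, E.symm (a, b) i = a i := by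
      intro i
      simp only [E, Equiv.piEquivPiSubtypeProd_symm_apply]
      rw [dif_pos i.2]
    have h4 : ∀ i : {i // ¬ r i}, E.symm (a, b) i = b i := by
      intro i
      simp only [E, Equiv.piEquivPiSubtypeProd_symm_apply]
      rw [dif_neg i.2]
    have h5 : (fun k => E.symm (a, b) (e k)) = fun k => a (O k) := by
      funext k; exact h3 (O k)
    rw [h5, ← Fintype.prod_subtype_mul_prod_subtype r]
    have h6 : ∏ i : {i // r i}, p i (E.symm (a, b) i) = ∏ k, p (e k) (a (O k)) := by
      rw [← O.prod_comp]
      refine Finset.prod_congr rfl fun k _ => ?_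
      rw [h3]; rfl
    have h7 : ∏ i : {i // ¬ r i}, p i (E.symm (a, b) i) = ∏ i : {i // ¬ r i}, p i.1 (b i) :=
      Finset.prod_congr rfl fun i _ => by rw [h4 i]
    rw [h6, h7]
    ring
  simp_rw [h2, ← Finset.mul_sum]
  rw [sum_pi_prod_one (fun i : {i // ¬ r i} => p i.1) (fun i => hp i.1)]
  simp only [mul_one]
  let F : (κ → Y) ≃ ({i // r i} → Y) := Equiv.arrowCongr O (Equiv.refl Y)
  rw [← F.sum_comp]
  refine Finset.sum_congr rfl fun z _ => ?_
  have : ∀ k, F z (O k) = z k := by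
    intro k
    simp only [F, Equiv.arrowCongr_apply, Function.comp, Equiv.refl_apply,
      Equiv.symm_apply_apply]
  simp only [this]

/-! ### One-shot superposition coding -/

theorem superposition {U V Z1 Z2 : Type} [Fintype U] [Fintype V] [Fintype Z1] [Fintype Z2]
    [Nonempty U] [Nonempty V] (P : V → U → Z1 × Z2 → ℝ) (hP0 : ∀ v u z, 0 ≤ P v u z)
    (hP1 : ∀ v u, ∑ z, P v u z = 1)
    (w2 : U → Z2 → ℝ) (w1 : V → U → Z1 → ℝ) (w0 : V → U → Z1 → ℝ)
    (hw2 : ∀ u z, 0 ≤ w2 u z) (hw1 : ∀ v u z, 0 ≤ w1 v u z) (hw0 : ∀ v u z, 0 ≤ w0 v u z)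
    (hE2 : ∀ z, 𝔼 u, w2 u z ≤ 1) (hE1 : ∀ u z, 𝔼 v, w1 v u z ≤ 1)
    (hE0 : ∀ z, 𝔼 u, 𝔼 v, w0 v u z ≤ 1)
    (T2 T1 T0 : ℝ) (hT2 : 0 < T2) (hT1 : 0 < T1) (hT0 : 0 < T0) (δ : ℝ)
    (hδ : 𝔼 u, 𝔼 v, ∑ z, P v u z * ((if w2 u z.2 < T2 then 1 else 0)
      + (if w1 v u z.1 < T1 then 1 else 0) + (if w0 v u z.1 < T0 then 1 else 0)) ≤ δ)
    (k1 k2 : ℕ) (hk1 : 0 < k1) (hk2 : 0 < k2) :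
    ∃ (c2 : Fin k2 → U) (c1 : Fin k1 × Fin k2 → V) (g1 : Z1 → Fin k1) (g2 : Z2 → Fin k2),
      (1 : ℝ) / ((k1 : ℝ) * (k2 : ℝ)) * ∑ m : Fin k1 × Fin k2, ∑ z : Z1 × Z2,
        P (c1 m) (c2 m.2) z * (if g1 z.1 = m.1 ∧ g2 z.2 = m.2 then 0 else 1)
      ≤ δ + k2 / T2 + k1 / T1 + k1 * k2 / T0 := by
  have : NeZero k1 := ⟨hk1.ne'⟩
  have : NeZero k2 := ⟨hk2.ne'⟩
  -- decoders
  let g2 : (Fin k2 → U) → Z2 → Fin k2 := fun c2 z =>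
    if h : ∃ m, T2 ≤ w2 (c2 m) z then h.choose else 0
  let Q : (Fin k2 → U) → (Fin k1 × Fin k2 → V) → Z1 → Fin k1 × Fin k2 → Prop :=
    fun c2 c1 z m => T1 ≤ w1 (c1 m) (c2 m.2) z ∧ T0 ≤ w0 (c1 m) (c2 m.2) z
  let g1 : (Fin k2 → U) → (Fin k1 × Fin k2 → V) → Z1 → Fin k1 := fun c2 c1 z =>
    if h : ∃ m, Q c2 c1 z m then h.choose.1 else 0
  let B : (Fin k2 → U) → (Fin k1 × Fin k2 → V) → Fin k1 × Fin k2 → Z1 × Z2 → ℝ :=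
    fun c2 c1 m z =>
      ((if w2 (c2 m.2) z.2 < T2 then 1 else 0)
      + (if w1 (c1 m) (c2 m.2) z.1 < T1 then 1 else 0)
      + (if w0 (c1 m) (c2 m.2) z.1 < T0 then 1 else 0))
      + (∑ j : Fin k2, if j = m.2 then 0 else w2 (c2 j) z.2 / T2)
      + (∑ i : Fin k1, if i = m.1 then 0 else w1 (c1 (i, m.2)) (c2 m.2) z.1 / T1)
      + (∑ q : Fin k1 × Fin k2, if q.2 = m.2 then 0 else w0 (c1 q) (c2 q.2) z.1 / T0)
  have hB : ∀ c2 c1 m z,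
      (if g1 c2 c1 z.1 = m.1 ∧ g2 c2 z.2 = m.2 then (0:ℝ) else 1) ≤ B c2 c1 m z := by
    intro c2 c1 m z
    have s2 : ∀ j : Fin k2, 0 ≤ (if j = m.2 then 0 else w2 (c2 j) z.2 / T2) := by
      intro j; split_ifs
      · exact le_rfl
      · exact div_nonneg (hw2 _ _) hT2.le
    have s1 : ∀ i : Fin k1,
        0 ≤ (if i = m.1 then 0 else w1 (c1 (i, m.2)) (c2 m.2) z.1 / T1) := by
      intro j; split_ifs
      · exact le_rfl
      · exact div_nonneg (hw1 _ _ _) hT1.le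
    have s0 : ∀ q : Fin k1 × Fin k2,
        0 ≤ (if q.2 = m.2 then 0 else w0 (c1 q) (c2 q.2) z.1 / T0) := by
      intro j; split_ifs
      · exact le_rfl
      · exact div_nonneg (hw0 _ _ _) hT0.le
    have t2 := Finset.sum_nonneg fun j (_ : j ∈ univ) => s2 j
    have t1 := Finset.sum_nonneg fun j (_ : j ∈ univ) => s1 j
    have t0 := Finset.sum_nonneg fun j (_ : j ∈ univ) => s0 j
    have i2 : (0:ℝ) ≤ (if w2 (c2 m.2) z.2 < T2 then 1 else 0) := by split_ifs <;> norm_num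
    have i1 : (0:ℝ) ≤ (if w1 (c1 m) (c2 m.2) z.1 < T1 then 1 else 0) := by
      split_ifs <;> norm_num
    have i0 : (0:ℝ) ≤ (if w0 (c1 m) (c2 m.2) z.1 < T0 then 1 else 0) := by
      split_ifs <;> norm_num
    simp only [B]
    by_cases hg : g1 c2 c1 z.1 = m.1 ∧ g2 c2 z.2 = m.2
    · rw [if_pos hg]; linarith
    rw [if_neg hg]
    by_cases c2t : w2 (c2 m.2) z.2 < T2
    · rw [if_pos c2t] at i2 ⊢; linarith
    by_cases c1t : w1 (c1 m) (c2 m.2) z.1 < T1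
    · rw [if_pos c1t] at i1 ⊢; linarith
    by_cases c0t : w0 (c1 m) (c2 m.2) z.1 < T0
    · rw [if_pos c0t] at i0 ⊢; linarith
    push Not at c2t c1t c0t
    rcases not_and_or.mp hg with hg | hg
    · have hex : ∃ q, Q c2 c1 z.1 q := ⟨m, c1t, c0t⟩
      have hgc : g1 c2 c1 z.1 = hex.choose.1 := dif_pos hex
      have hs := hex.choose_spec
      rw [hgc] at hg
      set q := hex.choose with hq
      by_cases h2 : q.2 = m.2
      · have hle := Finset.single_le_sum (fun j _ => s1 j) (Finset.mem_univ q.1)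
        rw [if_neg hg] at hle
        have hqq : (q.1, m.2) = q := by rw [← h2]
        rw [hqq, ← h2] at hle
        have : 1 ≤ w1 (c1 q) (c2 q.2) z.1 / T1 := by
          rw [le_div_iff₀ hT1, one_mul]; exact hs.1
        rw [h2] at hle this
        linarith
      · have hle := Finset.single_le_sum (fun j _ => s0 j) (Finset.mem_univ q)
        rw [if_neg h2] at hle
        have : 1 ≤ w0 (c1 q) (c2 q.2) z.1 / T0 := by
          rw [le_div_iff₀ hT0, one_mul]; exact hs.2
        linarith
    · have hex : ∃ q, T2 ≤ w2 (c2 q) z.2 := ⟨m.2, c2t⟩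
      have hgc : g2 c2 z.2 = hex.choose := dif_pos hex
      have hs := hex.choose_spec
      rw [hgc] at hg
      have hle := Finset.single_le_sum (fun j _ => s2 j) (Finset.mem_univ hex.choose)
      rw [if_neg hg] at hle
      have : 1 ≤ w2 (c2 hex.choose) z.2 / T2 := by
        rw [le_div_iff₀ hT2, one_mul]; exact hs
      linarith
  -- per-message bound
  have hPw : ∀ v u (w : Z1 × Z2 → ℝ), (∀ z, w z ≤ 1) → ∑ z, P v u z * w z ≤ 1 := by
    intro v u w hw
    calc ∑ z, P v u z * w z ≤ ∑ z, P v u z * 1 :=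
          Finset.sum_le_sum fun z _ => mul_le_mul_of_nonneg_left (hw z) (hP0 _ _ _)
      _ = 1 := by simp [hP1]
  have hm : ∀ m : Fin k1 × Fin k2,
      𝔼 c2 : Fin k2 → U, 𝔼 c1 : Fin k1 × Fin k2 → V, ∑ z, P (c1 m) (c2 m.2) z * B c2 c1 m z
      ≤ δ + k2 / T2 + k1 / T1 + k1 * k2 / T0 := by
    intro m
    have e0 : 𝔼 c2 : Fin k2 → U, 𝔼 c1 : Fin k1 × Fin k2 → V, ∑ z, P (c1 m) (c2 m.2) z *
        ((if w2 (c2 m.2) z.2 < T2 then 1 else 0)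
      + (if w1 (c1 m) (c2 m.2) z.1 < T1 then 1 else 0)
      + (if w0 (c1 m) (c2 m.2) z.1 < T0 then 1 else 0)) ≤ δ := by
      have := fun c2 : Fin k2 → U => expect_coord m (fun v => ∑ z, P v (c2 m.2) z *
        ((if w2 (c2 m.2) z.2 < T2 then 1 else 0)
        + (if w1 v (c2 m.2) z.1 < T1 then 1 else 0)
        + (if w0 v (c2 m.2) z.1 < T0 then 1 else 0)))
      simp_rw [this]
      have := expect_coord m.2 (fun u => 𝔼 v, ∑ z, P v u z *
        ((if w2 u z.2 < T2 then 1 else 0)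
        + (if w1 v u z.1 < T1 then 1 else 0)
        + (if w0 v u z.1 < T0 then 1 else 0)))
      rw [this]
      exact hδ
    have e2 : ∀ j, j ≠ m.2 → 𝔼 c2 : Fin k2 → U, 𝔼 c1 : Fin k1 × Fin k2 → V,
        ∑ z, P (c1 m) (c2 m.2) z * w2 (c2 j) z.2 ≤ 1 := by
      intro j hj
      rw [expect_resample j]
      refine Finset.expect_le Finset.univ_nonempty fun c2 _ => ?_
      rw [Finset.expect_comm]
      refine Finset.expect_le Finset.univ_nonempty fun c1 _ => ?_
      rw [Finset.expect_sum_comm]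
      simp only [Function.update_of_ne hj.symm, Function.update_self, ← Finset.mul_expect]
      exact hPw _ _ _ fun z => hE2 _
    have e1 : ∀ i, i ≠ m.1 → 𝔼 c2 : Fin k2 → U, 𝔼 c1 : Fin k1 × Fin k2 → V,
        ∑ z, P (c1 m) (c2 m.2) z * w1 (c1 (i, m.2)) (c2 m.2) z.1 ≤ 1 := by
      intro i hi
      refine Finset.expect_le Finset.univ_nonempty fun c2 _ => ?_
      rw [expect_resample (i, m.2)]
      refine Finset.expect_le Finset.univ_nonempty fun c1 _ => ?_
      rw [Finset.expect_sum_comm]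
      have hne : m ≠ (i, m.2) := fun h => hi (by rw [h])
      simp only [Function.update_of_ne hne, Function.update_self, ← Finset.mul_expect]
      exact hPw _ _ _ fun z => hE1 _ _
    have e3 : ∀ q : Fin k1 × Fin k2, q.2 ≠ m.2 →
        𝔼 c2 : Fin k2 → U, 𝔼 c1 : Fin k1 × Fin k2 → V,
        ∑ z, P (c1 m) (c2 m.2) z * w0 (c1 q) (c2 q.2) z.1 ≤ 1 := by
      intro q hq
      rw [expect_resample q.2]
      refine Finset.expect_le Finset.univ_nonempty fun c2 _ => ?_
      rw [Finset.expect_comm, expect_resample q]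
      refine Finset.expect_le Finset.univ_nonempty fun c1 _ => ?_
      rw [Finset.expect_comm]
      have hne : m ≠ q := fun h => hq (by rw [h])
      simp only [Finset.expect_sum_comm]
      simp only [Function.update_of_ne hne, Function.update_of_ne hq.symm,
        Function.update_self, ← Finset.mul_expect]
      exact hPw _ _ _ fun z => hE0 _
    have key : ∀ (c2 : Fin k2 → U) (c1 : Fin k1 × Fin k2 → V),
        ∑ z, P (c1 m) (c2 m.2) z * B c2 c1 m z =
        (∑ z, P (c1 m) (c2 m.2) z *
          ((if w2 (c2 m.2) z.2 < T2 then 1 else 0)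
          + (if w1 (c1 m) (c2 m.2) z.1 < T1 then 1 else 0)
          + (if w0 (c1 m) (c2 m.2) z.1 < T0 then 1 else 0)))
        + (∑ j : Fin k2, if j = m.2 then 0 else
            (∑ z, P (c1 m) (c2 m.2) z * w2 (c2 j) z.2) / T2)
        + (∑ i : Fin k1, if i = m.1 then 0 else
            (∑ z, P (c1 m) (c2 m.2) z * w1 (c1 (i, m.2)) (c2 m.2) z.1) / T1)
        + (∑ q : Fin k1 × Fin k2, if q.2 = m.2 then 0 else
            (∑ z, P (c1 m) (c2 m.2) z * w0 (c1 q) (c2 q.2) z.1) / T0) := by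
      intro c2 c1
      simp only [B, mul_add, Finset.sum_add_distrib, Finset.mul_sum]
      congr 1
      · congr 1
        · congr 1
          rw [Finset.sum_comm]
          refine Finset.sum_congr rfl fun j _ => ?_
          split_ifs
          · simp
          · rw [Finset.sum_div]; refine Finset.sum_congr rfl fun z _ => by ring
        · rw [Finset.sum_comm]
          refine Finset.sum_congr rfl fun j _ => ?_
          split_ifs
          · simp
          · rw [Finset.sum_div]; refine Finset.sum_congr rfl fun z _ => by ring
      · rw [Finset.sum_comm]
        refine Finset.sum_congr rfl fun j _ => ?_
        split_ifs
        · simp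
        · rw [Finset.sum_div]; refine Finset.sum_congr rfl fun z _ => by ring
    simp_rw [key, Finset.expect_add_distrib]
    have f2 : 𝔼 c2 : Fin k2 → U, 𝔼 c1 : Fin k1 × Fin k2 → V,
        (∑ j : Fin k2, if j = m.2 then 0 else
            (∑ z, P (c1 m) (c2 m.2) z * w2 (c2 j) z.2) / T2) ≤ k2 / T2 := by
      simp_rw [Finset.expect_sum_comm]
      calc _ ≤ ∑ j : Fin k2, 1 / T2 := by
            refine Finset.sum_le_sum fun j _ => ?_
            by_cases hj : j = m.2
            · simp [hj, hT2.le]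
            · simp only [if_neg hj, ← Finset.expect_div]
              exact div_le_div_of_nonneg_right (e2 j hj) hT2.le
        _ = k2 / T2 := by simp [div_eq_mul_inv]
    have f1 : 𝔼 c2 : Fin k2 → U, 𝔼 c1 : Fin k1 × Fin k2 → V,
        (∑ i : Fin k1, if i = m.1 then 0 else
            (∑ z, P (c1 m) (c2 m.2) z * w1 (c1 (i, m.2)) (c2 m.2) z.1) / T1) ≤ k1 / T1 := by
      simp_rw [Finset.expect_sum_comm]
      calc _ ≤ ∑ j : Fin k1, 1 / T1 := by
            refine Finset.sum_le_sum fun j _ => ?_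
            by_cases hj : j = m.1
            · simp [hj, hT1.le]
            · simp only [if_neg hj, ← Finset.expect_div]
              exact div_le_div_of_nonneg_right (e1 j hj) hT1.le
        _ = k1 / T1 := by simp [div_eq_mul_inv]
    have f0 : 𝔼 c2 : Fin k2 → U, 𝔼 c1 : Fin k1 × Fin k2 → V,
        (∑ q : Fin k1 × Fin k2, if q.2 = m.2 then 0 else
            (∑ z, P (c1 m) (c2 m.2) z * w0 (c1 q) (c2 q.2) z.1) / T0) ≤ k1 * k2 / T0 := by
      simp_rw [Finset.expect_sum_comm]
      calc _ ≤ ∑ j : Fin k1 × Fin k2, 1 / T0 := by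
            refine Finset.sum_le_sum fun j _ => ?_
            by_cases hj : j.2 = m.2
            · simp [hj, hT0.le]
            · simp only [if_neg hj, ← Finset.expect_div]
              exact div_le_div_of_nonneg_right (e3 j hj) hT0.le
        _ = k1 * k2 / T0 := by simp [div_eq_mul_inv]
    linarith
  have hk : (0:ℝ) < (k1:ℝ) * k2 := by positivity
  have htot : 𝔼 c : (Fin k2 → U) × (Fin k1 × Fin k2 → V),
      ((1 : ℝ) / ((k1 : ℝ) * (k2 : ℝ)) * ∑ m : Fin k1 × Fin k2, ∑ z : Z1 × Z2,
        P (c.2 m) (c.1 m.2) z *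
          (if g1 c.1 c.2 z.1 = m.1 ∧ g2 c.1 z.2 = m.2 then 0 else 1))
      ≤ δ + k2 / T2 + k1 / T1 + k1 * k2 / T0 := by
    rw [← Finset.univ_product_univ, Finset.expect_product]
    simp_rw [← Finset.mul_expect, Finset.expect_sum_comm]
    rw [one_div, inv_mul_le_iff₀ hk]
    calc _ ≤ ∑ m : Fin k1 × Fin k2, (δ + k2 / T2 + k1 / T1 + k1 * k2 / T0) := by
          refine Finset.sum_le_sum fun m _ => ?_
          refine le_trans ?_ (hm m)
          simp_rw [Finset.expect_sum_comm]
          refine Finset.sum_le_sum fun z _ => ?_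
          refine Finset.expect_le_expect fun c2 _ => Finset.expect_le_expect fun c1 _ => ?_
          exact mul_le_mul_of_nonneg_left (hB c2 c1 m z) (hP0 _ _ _)
      _ = _ := by
          rw [Finset.sum_const, nsmul_eq_mul]; simp
  obtain ⟨c, -, hc⟩ := Finset.exists_le_of_expect_le Finset.univ_nonempty htot
  exact ⟨c.1, c.2, g1 c.1 c.2, g2 c.1, hc⟩

/-! ### Products of scores -/

theorem expect_pi_prod {α β : Type} [Fintype α] [DecidableEq α] [Fintype β]
    (h : α → β → ℝ) : 𝔼 c : α → β, ∏ a, h a (c a) = ∏ a, 𝔼 b, h a b := by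
  simp_rw [Fintype.expect_eq_sum_div_card]
  rw [Finset.prod_div_distrib, Finset.prod_univ_sum, Fintype.piFinset_univ]
  simp

theorem expect_score (l : ℕ) (i : Fin l) (η : ℝ) (hη0 : 0 ≤ η) :
    𝔼 b : Fin l, (if i = b then (1 - η) * (l : ℝ) else η) ≤ 1 := by
  have hl : (0:ℝ) < l := by
    have := i.pos
    exact_mod_cast this
  have h1 : ∀ b : Fin l, (if i = b then (1 - η) * (l : ℝ) else η)
      ≤ η + (if i = b then (1 - η) * l else 0) := by
    intro b; split_ifs <;> linarith
  calc _ ≤ 𝔼 b : Fin l, (η + (if i = b then (1 - η) * (l:ℝ) else 0)) :=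
        Finset.expect_le_expect fun b _ => h1 b
    _ = 1 := by
        have : Nonempty (Fin l) := ⟨i⟩
        rw [Finset.expect_add_distrib, Fintype.expect_const, Fintype.expect_eq_sum_div_card]
        simp
        field_simp
        ring

/-- If the product of the scores is below the threshold, then many scores are bad. -/
theorem score_threshold {α : Type} [Fintype α] [Nonempty α] (w : α → ℝ) (bad : α → Prop)
    (k n η lam ρ t : ℝ) (hη : 0 < η) (hk : 1 ≤ k) (hηl : η ≤ lam) (hlam : lam ≤ 1)
    (hρ0 : 0 < ρ) (hw : ∀ a, η ≤ w a)
    (hgood : ∀ a, ¬ bad a → lam * k ≤ w a)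
    (hcond : n * t ≤ (1 - ρ) * Real.logb 2 k + Real.logb 2 lam + ρ * Real.logb 2 η) :
    (if ∏ a, w a < (2:ℝ) ^ ((Fintype.card α : ℝ) * n * t) then (1:ℝ) else 0)
      ≤ (∑ a, if bad a then (1:ℝ) else 0) / (ρ * Fintype.card α) := by
  have hr : (0:ℝ) < Fintype.card α := by exact_mod_cast Fintype.card_pos
  have hF0 : (0:ℝ) ≤ ∑ a, if bad a then (1:ℝ) else 0 :=
    Finset.sum_nonneg fun a _ => by split_ifs <;> norm_num
  by_cases hF : ρ * Fintype.card α ≤ ∑ a, if bad a then (1:ℝ) else 0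
  · have : 1 ≤ (∑ a, if bad a then (1:ℝ) else 0) / (ρ * Fintype.card α) := by
      rw [le_div_iff₀ (by positivity), one_mul]; exact hF
    split_ifs <;> linarith
  · push Not at hF
    have hlam0 : 0 < lam := hη.trans_le hηl
    rw [if_neg]
    · positivity
    · rw [not_lt]
      have hwpos : ∀ a, 0 < w a := fun a => hη.trans_le (hw a)
      have hprod : 0 < ∏ a, w a := Finset.prod_pos fun a _ => hwpos a
      rw [← Real.le_logb_iff_rpow_le (by norm_num) hprod]
      rw [Real.logb_prod univ w fun a _ => (hwpos a).ne']
      set L := Real.logb 2 (lam * k) with hL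
      have hL' : L = Real.logb 2 lam + Real.logb 2 k :=
        Real.logb_mul hlam0.ne' (by linarith)
      have hlog1 : Real.logb 2 lam ≤ 0 := Real.logb_nonpos (by norm_num) hlam0.le hlam
      have hρlam : Real.logb 2 η ≤ L := by
        refine Real.logb_le_logb_of_le (by norm_num) hη ?_
        nlinarith
      have hterm : ∀ a, L - (if bad a then (1:ℝ) else 0) * (L - Real.logb 2 η)
          ≤ Real.logb 2 (w a) := by
        intro a
        by_cases hb : bad a
        · simp only [hb, if_true]
          have := Real.logb_le_logb_of_le (b := 2) (by norm_num) hη (hw a)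
          linarith
        · simp only [hb, if_false]
          have := Real.logb_le_logb_of_le (b := 2) (by norm_num)
            (by positivity : 0 < lam * k) (hgood a hb)
          linarith
      have hsum := Finset.sum_le_sum fun a (_ : a ∈ univ) => hterm a
      rw [Finset.sum_sub_distrib, ← Finset.sum_mul] at hsum
      simp only [Finset.sum_const, Finset.card_univ, nsmul_eq_mul] at hsum
      refine le_trans ?_ hsum
      have h1 : (∑ a, if bad a then (1:ℝ) else 0) * (L - Real.logb 2 η)
          ≤ ρ * Fintype.card α * (L - Real.logb 2 η) :=
        mul_le_mul_of_nonneg_right hF.le (by linarith)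
      have h2 : n * t ≤ (1 - ρ) * L + ρ * Real.logb 2 η := by
        rw [hL']
        nlinarith
      nlinarith

/-! ### Marginals and shifts of the memoryless channel -/

section Blocks

variable {X Y1 Y2 : Type} [Fintype Y1] [Fintype Y2]

/-- Memoryless extension over an arbitrary finite index set. -/
def nFoldI {ι : Type} [Fintype ι] (W : X → Y1 × Y2 → ℝ) (x : ι → X)
    (y : (ι → Y1) × (ι → Y2)) : ℝ := ∏ i, W (x i) (y.1 i, y.2 i)

theorem margW1_sum (W : X → Y1 × Y2 → ℝ) (hW : IsChannel W) (x : X) :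
    ∑ y, margW1 W x y = 1 := by
  rw [← (hW x).2, Fintype.sum_prod_type]; rfl

theorem margW2_sum (W : X → Y1 × Y2 → ℝ) (hW : IsChannel W) (x : X) :
    ∑ y, margW2 W x y = 1 := by
  rw [← (hW x).2, Fintype.sum_prod_type_right]; rfl

theorem nFoldI_marg1 {ι κ : Type} [Fintype ι] [Fintype κ] [DecidableEq ι] [DecidableEq κ]
    (W : X → Y1 × Y2 → ℝ) (hW : IsChannel W) (x : ι → X) (e : κ → ι)
    (he : Function.Injective e) (G : (κ → Y1) → ℝ) :
    ∑ y, nFoldI W x y * G (fun k => y.1 (e k))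
      = ∑ z : κ → Y1, (∏ k, margW1 W (x (e k)) (z k)) * G z := by
  rw [← sum_pi_marginal (fun i => margW1 W (x i)) (fun i => margW1_sum W hW _) e he,
    Fintype.sum_prod_type]
  refine Finset.sum_congr rfl fun y1 _ => ?_
  dsimp only
  rw [← Finset.sum_mul]
  congr 1
  simp only [margW1, nFoldI]
  rw [Finset.prod_univ_sum, Fintype.piFinset_univ]

theorem nFoldI_marg2 {ι κ : Type} [Fintype ι] [Fintype κ] [DecidableEq ι] [DecidableEq κ]
    (W : X → Y1 × Y2 → ℝ) (hW : IsChannel W) (x : ι → X) (e : κ → ι)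
    (he : Function.Injective e) (G : (κ → Y2) → ℝ) :
    ∑ y, nFoldI W x y * G (fun k => y.2 (e k))
      = ∑ z : κ → Y2, (∏ k, margW2 W (x (e k)) (z k)) * G z := by
  rw [← sum_pi_marginal (fun i => margW2 W (x i)) (fun i => margW2_sum W hW _) e he,
    Fintype.sum_prod_type_right]
  refine Finset.sum_congr rfl fun y1 _ => ?_
  dsimp only
  rw [← Finset.sum_mul]
  congr 1
  simp only [margW2, nFoldI]
  rw [Finset.prod_univ_sum, Fintype.piFinset_univ]

theorem nFoldI_nonneg {ι : Type} [Fintype ι] (W : X → Y1 × Y2 → ℝ) (hW : IsChannel W)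
    (x : ι → X) (y : (ι → Y1) × (ι → Y2)) : 0 ≤ nFoldI W x y :=
  Finset.prod_nonneg fun i _ => (hW _).1 _

theorem nFoldI_sum {ι : Type} [Fintype ι] [DecidableEq ι] (W : X → Y1 × Y2 → ℝ)
    (hW : IsChannel W) (x : ι → X) : ∑ y, nFoldI W x y = 1 := by
  have := nFoldI_marg1 W hW x id Function.injective_id (fun _ => 1)
  simp only [mul_one] at this
  rw [this]
  exact sum_pi_prod_one _ fun i => margW1_sum W hW _

end Blocks

theorem shift_sum {M : ℕ} [NeZero M] {Y κ : Type} [Fintype Y] [Fintype κ] [DecidableEq κ]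
    (K : Fin M → Y → ℝ) (σ : Fin M → Equiv.Perm Y)
    (hσ : ∀ x s y, K (x + s) (σ s y) = K x y) (x s : κ → Fin M) (G : (κ → Y) → ℝ) :
    ∑ z : κ → Y, (∏ k, K (x k) (z k)) * G (fun k => σ (s k) (z k))
      = ∑ z : κ → Y, (∏ k, K (x k + s k) (z k)) * G z := by
  conv_rhs => rw [← (Equiv.piCongrRight fun k => σ (s k)).sum_comp]
  refine Finset.sum_congr rfl fun z _ => ?_
  have h2 : (Equiv.piCongrRight fun k => σ (s k)) z = fun k => σ (s k) (z k) := rfl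
  simp only [h2, hσ]

theorem unshift_sum {M : ℕ} [NeZero M] {Y κ : Type} [Fintype Y] [Fintype κ] [DecidableEq κ]
    (K : Fin M → Y → ℝ) (σ : Fin M → Equiv.Perm Y)
    (hσ : ∀ x s y, K (x + s) (σ s y) = K x y) (x s : κ → Fin M) (G : (κ → Y) → ℝ) :
    ∑ z : κ → Y, (∏ k, K (x k + s k) (z k)) * G (fun k => (σ (s k)).symm (z k))
      = ∑ z : κ → Y, (∏ k, K (x k) (z k)) * G z := by
  rw [← shift_sum K σ hσ x s]
  simp

theorem circSym_shift {M : ℕ} [NeZero M] {Y : Type} (K : Fin M → Y → ℝ) (h : CircSym K) :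
    ∃ σ : Fin M → Equiv.Perm Y, ∀ x s y, K (x + s) (σ s y) = K x y := by
  obtain ⟨μ, hM, hK⟩ := h
  have hmul : ∀ q y, (⇑μ)^[M * q] y = y := by
    intro q y
    rw [Function.iterate_mul]
    have : (⇑μ)^[M] = id := funext hM
    rw [this]; simp
  have hmod : ∀ j y, (⇑μ)^[j % M] y = (⇑μ)^[j] y := by
    intro j y
    conv_rhs => rw [← Nat.mod_add_div j M, Function.iterate_add_apply, hmul]
  refine ⟨fun s => μ ^ (s : ℕ), fun x s y => ?_⟩
  obtain ⟨z, rfl⟩ : ∃ z, (⇑μ)^[(x:ℕ)] z = y := (μ.bijective.iterate x).surjective y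
  rw [hK]
  have : (μ ^ (s:ℕ)) ((⇑μ)^[(x:ℕ)] z) = (⇑μ)^[((x + s : Fin M) : ℕ)] z := by
    rw [Fin.val_add, hmod, ← Equiv.Perm.iterate_eq_pow, ← Function.iterate_add_apply, add_comm]
  rw [this, hK]

/-! ### The score built from a code for receiver 1 -/

section Score

variable {M : ℕ} [NeZero M] {Y : Type} [Fintype Y] {n k : ℕ}

/-- Number of messages whose suitably shifted codeword is compatible with `(x, y)`. -/
def cnt (σ : Fin M → Equiv.Perm Y) (f : Fin k → Fin n → Fin M) (g : (Fin n → Y) → Fin k)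
    (x : Fin n → Fin M) (y : Fin n → Y) : ℝ :=
  ∑ m, if g (fun t => σ (f m t - x t) (y t)) = m then 1 else 0

theorem cnt_nonneg (σ : Fin M → Equiv.Perm Y) (f : Fin k → Fin n → Fin M)
    (g : (Fin n → Y) → Fin k) (x : Fin n → Fin M) (y : Fin n → Y) : 0 ≤ cnt σ f g x y :=
  Finset.sum_nonneg fun m _ => by split_ifs <;> norm_num

theorem cnt_compl (σ : Fin M → Equiv.Perm Y) (f : Fin k → Fin n → Fin M)
    (g : (Fin n → Y) → Fin k) (x : Fin n → Fin M) (y : Fin n → Y) :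
    (k : ℝ) - cnt σ f g x y
      = ∑ m, if g (fun t => σ (f m t - x t) (y t)) = m then 0 else 1 := by
  have : (k : ℝ) = ∑ m : Fin k, 1 := by simp
  rw [this, cnt, ← Finset.sum_sub_distrib]
  refine Finset.sum_congr rfl fun m _ => ?_
  split_ifs <;> norm_num

theorem expect_cnt (σ : Fin M → Equiv.Perm Y) (f : Fin k → Fin n → Fin M)
    (g : (Fin n → Y) → Fin k) (y : Fin n → Y) : 𝔼 x, cnt σ f g x y = 1 := by
  simp only [cnt]
  rw [Finset.expect_sum_comm]
  have h : ∀ m : Fin k,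
      𝔼 x : Fin n → Fin M, (if g (fun t => σ (f m t - x t) (y t)) = m then (1:ℝ) else 0)
      = 𝔼 d : Fin n → Fin M, (if g (fun t => σ (d t) (y t)) = m then (1:ℝ) else 0) := by
    intro m
    exact Fintype.expect_equiv (Equiv.subLeft (f m)) _ _ fun x => rfl
  simp_rw [h]
  rw [← Finset.expect_sum_comm]
  simp

theorem cnt_err (K : Fin M → Y → ℝ) (σ : Fin M → Equiv.Perm Y)
    (hσ : ∀ x s y, K (x + s) (σ s y) = K x y) (f : Fin k → Fin n → Fin M)
    (g : (Fin n → Y) → Fin k) (x : Fin n → Fin M) :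
    ∑ z : Fin n → Y, (∏ t, K (x t) (z t)) * ((k : ℝ) - cnt σ f g x z)
      = ∑ m, ∑ z : Fin n → Y, (∏ t, K (f m t) (z t)) * (if g z = m then 0 else 1) := by
  simp_rw [cnt_compl, Finset.mul_sum]
  rw [Finset.sum_comm]
  refine Finset.sum_congr rfl fun m _ => ?_
  rw [shift_sum K σ hσ x (fun t => f m t - x t) (fun z => if g z = m then 0 else 1)]
  simp

end Score

theorem expect_blocks {n p J M : ℕ} (h : Fin n × Fin J → (Fin p → Fin M) → ℝ) :
    𝔼 x : Fin n × Fin p × Fin J → Fin M, ∏ b, h b (fun t => x (b.1, t, b.2))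
      = ∏ b, 𝔼 x : Fin p → Fin M, h b x := by
  rw [← expect_pi_prod]
  let E : (Fin n × Fin p × Fin J → Fin M) ≃ (Fin n × Fin J → Fin p → Fin M) :=
    { toFun := fun x b t => x (b.1, t, b.2)
      invFun := fun c i => c (i.1, i.2.2) i.2.1
      left_inv := fun x => rfl
      right_inv := fun c => rfl }
  exact Fintype.expect_equiv E _ _ fun x => rfl

/-! ### Error probabilities of the component code -/

section CompErr

variable {X Y1 Y2 : Type} [Fintype Y1] [Fintype Y2]

theorem nFold_eq (W : X → Y1 × Y2 → ℝ) (n : ℕ) (x : Fin n → X)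
    (y : (Fin n → Y1) × (Fin n → Y2)) : nFold W n x y = nFoldI W x y := rfl

theorem errA2 (W : X → Y1 × Y2 → ℝ) (hW : IsChannel W) (n k1 k2 : ℕ)
    (f : Fin k1 × Fin k2 → Fin n → X) (g1 : (Fin n → Y1) × Fin k2 → Fin k1)
    (g2 : (Fin n → Y2) → Fin k2) :
    𝔼 j : Fin k2, 𝔼 i : Fin k1,
      ∑ z : Fin n → Y2, (∏ t, margW2 W (f (i, j) t) (z t)) * (if g2 z = j then 0 else 1)
      ≤ errP1 W n k1 k2 f g1 g2 := by
  rw [Finset.expect_comm, errP1, ← Finset.expect_product' univ univ (fun (i : Fin k1) (j : Fin k2) =>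
    ∑ z : Fin n → Y2, (∏ t, margW2 W (f (i, j) t) (z t)) * (if g2 z = j then 0 else 1)),
    Finset.univ_product_univ, Fintype.expect_eq_sum_div_card, Fintype.card_prod, div_eq_inv_mul,
    one_div]
  simp only [Fintype.card_fin, Nat.cast_mul]
  refine mul_le_mul_of_nonneg_left (Finset.sum_le_sum fun m _ => ?_) (by positivity)
  refine le_trans (le_of_eq (nFoldI_marg2 W hW (f (m.1, m.2)) (fun k => k)
    Function.injective_id (fun z => if g2 z = m.2 then 0 else 1)).symm) ?_
  refine Finset.sum_le_sum fun y _ => ?_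
  rw [nFold_eq]
  refine mul_le_mul_of_nonneg_left ?_ (nFoldI_nonneg W hW _ _)
  change (if g2 y.2 = m.2 then (0:ℝ) else 1) ≤ _
  by_cases h : g2 y.2 = m.2
  · rw [if_pos h]; split_ifs <;> norm_num
  · rw [if_neg h, if_neg (fun h' => h h'.2)]

theorem errA1 (W : X → Y1 × Y2 → ℝ) (hW : IsChannel W) (n k1 k2 : ℕ)
    (f : Fin k1 × Fin k2 → Fin n → X) (g1 : (Fin n → Y1) × Fin k2 → Fin k1)
    (g2 : (Fin n → Y2) → Fin k2) :
    𝔼 j : Fin k2, 𝔼 i : Fin k1,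
      ∑ z : Fin n → Y1, (∏ t, margW1 W (f (i, j) t) (z t)) * (if g1 (z, j) = i then 0 else 1)
      ≤ errP1 W n k1 k2 f g1 g2 := by
  rw [Finset.expect_comm, errP1, ← Finset.expect_product' univ univ (fun (i : Fin k1) (j : Fin k2) =>
    ∑ z : Fin n → Y1, (∏ t, margW1 W (f (i, j) t) (z t)) * (if g1 (z, j) = i then 0 else 1)),
    Finset.univ_product_univ, Fintype.expect_eq_sum_div_card, Fintype.card_prod, div_eq_inv_mul,
    one_div]
  simp only [Fintype.card_fin, Nat.cast_mul]
  refine mul_le_mul_of_nonneg_left (Finset.sum_le_sum fun m _ => ?_) (by positivity)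
  refine le_trans (le_of_eq (nFoldI_marg1 W hW (f (m.1, m.2)) (fun k => k)
    Function.injective_id (fun z => if g1 (z, m.2) = m.1 then 0 else 1)).symm) ?_
  refine Finset.sum_le_sum fun y _ => ?_
  rw [nFold_eq]
  refine mul_le_mul_of_nonneg_left ?_ (nFoldI_nonneg W hW _ _)
  change (if g1 (y.1, m.2) = m.1 then (0:ℝ) else 1) ≤ _
  by_cases h : g1 (y.1, m.2) = m.1
  · rw [if_pos h]; split_ifs <;> norm_num
  · rw [if_neg h, if_neg (fun h' => h h'.1)]

end CompErr

theorem thr_sum {Z α : Type} [Fintype Z] [Fintype α] (P : Z → ℝ) (hP : ∀ z, 0 ≤ P z) (I : Z → ℝ)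
    (bad : α → Z → ℝ) (c : ℝ) (hc : 0 < c) (h : ∀ z, I z ≤ (∑ a, bad a z) / c) (E : α → ℝ)
    (hE : ∀ a, ∑ z, P z * bad a z ≤ E a) : ∑ z, P z * I z ≤ (∑ a, E a) / c := by
  calc ∑ z, P z * I z ≤ ∑ z, P z * ((∑ a, bad a z) / c) :=
        Finset.sum_le_sum fun z _ => mul_le_mul_of_nonneg_left (h z) (hP z)
    _ = (∑ a, ∑ z, P z * bad a z) / c := by
        rw [Finset.sum_comm, Finset.sum_div]
        refine Finset.sum_congr rfl fun z _ => ?_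
        rw [← Finset.mul_sum, mul_div_assoc]
    _ ≤ _ := by
        gcongr with a _
        exact hE a

theorem avg_comb {A S : Type} [Fintype A] [DecidableEq A] [Nonempty A] [Fintype S] [Nonempty S]
    {l1 l2 : ℕ} [NeZero l1] [NeZero l2] (e : Fin l1 → Fin l2 → ℝ) (ρ : ℝ) :
    𝔼 u : (A → Fin l2) × S, 𝔼 v : A → Fin l1, (∑ a, e (v a) (u.1 a)) / (ρ * Fintype.card A)
      = (𝔼 j, 𝔼 i, e i j) / ρ := by
  have hc : (Fintype.card A : ℝ) ≠ 0 := by exact_mod_cast Fintype.card_ne_zero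
  have h1 : ∀ u : (A → Fin l2) × S, 𝔼 v : A → Fin l1,
      (∑ a, e (v a) (u.1 a)) / (ρ * Fintype.card A)
      = (∑ a, 𝔼 i, e i (u.1 a)) / (ρ * Fintype.card A) := by
    intro u
    rw [← Finset.expect_div, Finset.expect_sum_comm]
    congr 1
    refine Finset.sum_congr rfl fun a _ => ?_
    exact expect_coord a (fun i => e i (u.1 a))
  simp_rw [h1]
  rw [← Finset.expect_div, ← Finset.univ_product_univ, Finset.expect_product,
    Finset.expect_comm]
  simp only
  rw [Fintype.expect_const, Finset.expect_sum_comm]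
  have h2 : ∀ a : A, 𝔼 u : A → Fin l2, 𝔼 i, e i (u a) = 𝔼 j, 𝔼 i, e i j := by
    intro a
    exact expect_coord a (fun j => 𝔼 i, e i j)
  simp_rw [h2]
  rw [Finset.sum_const, Finset.card_univ, nsmul_eq_mul, mul_comm ρ, mul_div_mul_left _ _ hc]

/-! ### The combined code -/

set_option maxHeartbeats 1000000 in
theorem core_index {M : ℕ} [NeZero M] {Y1 Y2 : Type} [Fintype Y1] [Fintype Y2]
    (W : Fin M → Y1 × Y2 → ℝ) (hW : IsChannel W)
    (σ1 : Fin M → Equiv.Perm Y1) (hσ1 : ∀ x s y, margW1 W (x + s) (σ1 s y) = margW1 W x y)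
    (σ2 : Fin M → Equiv.Perm Y2) (hσ2 : ∀ x s y, margW2 W (x + s) (σ2 s y) = margW2 W x y)
    (n l1 l2 : ℕ) (hn : 0 < n) (hl1 : 0 < l1) (hl2 : 0 < l2)
    (f : Fin l1 × Fin l2 → Fin n → Fin M) (g1 : (Fin n → Y1) × Fin l2 → Fin l1)
    (g2 : (Fin n → Y2) → Fin l2) (εA : ℝ) (hA : errP1 W n l1 l2 f g1 g2 ≤ εA)
    (p k : ℕ) (hp : 0 < p) (hk : 0 < k) (f' : Fin k → Fin p → Fin M)
    (g' : (Fin p → Y1) → Fin k) (εB : ℝ)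
    (hB : ∑ m, ∑ z : Fin p → Y1, (∏ t, margW1 W (f' m t) (z t)) * (if g' z = m then 0 else 1)
      ≤ k * εB)
    (η ρ : ℝ) (hη0 : 0 < η) (hη1 : η ≤ 1/4) (hρ0 : 0 < ρ)
    (t0 t1 t2 : ℝ)
    (ht1 : (n:ℝ) * t1 ≤ (1 - ρ) * Real.logb 2 l1 + Real.logb 2 ((1-η)^2) + ρ * Real.logb 2 η)
    (ht2 : (n:ℝ) * t2 ≤ (1 - ρ) * Real.logb 2 l2 + Real.logb 2 ((1-η)^2) + ρ * Real.logb 2 η)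
    (ht0 : (p:ℝ) * t0 ≤ (1 - ρ) * Real.logb 2 k + Real.logb 2 ((1-η)^2) + ρ * Real.logb 2 η)
    (J : ℕ) (hJ : 0 < J) (K1 K2 : ℕ) (hK1 : 0 < K1) (hK2 : 0 < K2) :
    ∃ (F : Fin K1 × Fin K2 → (Fin n × Fin p × Fin J) → Fin M)
      (G1 : (Fin n × Fin p × Fin J → Y1) → Fin K1)
      (G2 : (Fin n × Fin p × Fin J → Y2) → Fin K2),
      (1 : ℝ) / ((K1 : ℝ) * (K2 : ℝ)) * ∑ m : Fin K1 × Fin K2, ∑ y,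
        nFoldI W (F m) y * (if G1 y.1 = m.1 ∧ G2 y.2 = m.2 then 0 else 1)
      ≤ (εA / ρ + εA / ρ + εB / (η * ρ))
        + K2 / (2:ℝ) ^ ((((n * p * J : ℕ)) : ℝ) * t2)
        + K1 / (2:ℝ) ^ ((((n * p * J : ℕ)) : ℝ) * t1)
        + K1 * K2 / (2:ℝ) ^ ((((n * p * J : ℕ)) : ℝ) * t0) := by
  have : NeZero n := ⟨hn.ne'⟩
  have : NeZero p := ⟨hp.ne'⟩
  have : NeZero J := ⟨hJ.ne'⟩
  have : NeZero l1 := ⟨hl1.ne'⟩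
  have : NeZero l2 := ⟨hl2.ne'⟩
  have : NeZero k := ⟨hk.ne'⟩
  have hl1' : (1:ℝ) ≤ l1 := by exact_mod_cast hl1
  have hl2' : (1:ℝ) ≤ l2 := by exact_mod_cast hl2
  have hk' : (1:ℝ) ≤ k := by exact_mod_cast hk
  have hlam0 : 0 < (1 - η)^2 := by nlinarith
  have hlam1 : (1 - η)^2 ≤ 1 := by nlinarith
  have hlamη : η ≤ (1 - η)^2 := by nlinarith
  have hlam2 : (1 - η)^2 ≤ 1 - η := by nlinarith
  -- superletters
  let φ : (Fin p × Fin J → Fin l1) → (Fin p × Fin J → Fin l2) × (Fin n × Fin p × Fin J → Fin M) →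
      Fin n × Fin p × Fin J → Fin M := fun v u i => f (v i.2, u.1 i.2) i.1 + u.2 i
  let P : (Fin p × Fin J → Fin l1) → (Fin p × Fin J → Fin l2) × (Fin n × Fin p × Fin J → Fin M) →
      (Fin n × Fin p × Fin J → Y1) × (Fin n × Fin p × Fin J → Y2) → ℝ :=
    fun v u z => nFoldI W (φ v u) z
  let b1 : (Fin n × Fin p × Fin J → Fin M) → (Fin n × Fin p × Fin J → Y1) → Fin p × Fin J →
      Fin n → Y1 := fun s y a t => (σ1 (s (t, a))).symm (y (t, a))
  let b2 : (Fin n × Fin p × Fin J → Fin M) → (Fin n × Fin p × Fin J → Y2) → Fin p × Fin J →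
      Fin n → Y2 := fun s y a t => (σ2 (s (t, a))).symm (y (t, a))
  let w2 : (Fin p × Fin J → Fin l2) × (Fin n × Fin p × Fin J → Fin M) →
      (Fin n × Fin p × Fin J → Y2) → ℝ := fun u y =>
    ∏ a, if g2 (b2 u.2 y a) = u.1 a then (1 - η) * (l2:ℝ) else η
  let w1 : (Fin p × Fin J → Fin l1) → (Fin p × Fin J → Fin l2) × (Fin n × Fin p × Fin J → Fin M) →
      (Fin n × Fin p × Fin J → Y1) → ℝ := fun v u y =>
    ∏ a, if g1 (b1 u.2 y a, u.1 a) = v a then (1 - η) * (l1:ℝ) else η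
  let C : (Fin n × Fin p × Fin J → Fin M) → (Fin n × Fin p × Fin J → Y1) → Fin n × Fin J → ℝ :=
    fun x y b => cnt σ1 f' g' (fun t => x (b.1, t, b.2)) (fun t => y (b.1, t, b.2))
  let w0 : (Fin p × Fin J → Fin l1) → (Fin p × Fin J → Fin l2) × (Fin n × Fin p × Fin J → Fin M) →
      (Fin n × Fin p × Fin J → Y1) → ℝ := fun v u y =>
    ∏ b, (η + (1 - η) * C (φ v u) y b)
  have hN1 : ((Fintype.card (Fin p × Fin J) : ℕ) : ℝ) * n = ((n * p * J : ℕ) : ℝ) := by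
    simp; ring
  have hN0 : ((Fintype.card (Fin n × Fin J) : ℕ) : ℝ) * p = ((n * p * J : ℕ) : ℝ) := by
    simp; ring
  have scn : ∀ (l : ℝ) (q : Prop) [Decidable q], 1 ≤ l → η ≤ if q then (1 - η) * l else η := by
    intro l q _ hl
    split_ifs
    · nlinarith
    · exact le_rfl
  have hP0 : ∀ v u z, 0 ≤ P v u z := fun v u z => nFoldI_nonneg W hW _ _
  have hP1 : ∀ v u, ∑ z, P v u z = 1 := fun v u => nFoldI_sum W hW _
  have hCη : ∀ x y b, η ≤ η + (1 - η) * C x y b := by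
    intro x y b
    have : 0 ≤ C x y b := cnt_nonneg _ _ _ _ _
    nlinarith
  have hE2 : ∀ z, 𝔼 u, w2 u z ≤ 1 := by
    intro z
    rw [← Finset.univ_product_univ, Finset.expect_product, Finset.expect_comm]
    refine Finset.expect_le Finset.univ_nonempty fun s _ => ?_
    refine le_trans (le_of_eq (expect_pi_prod (fun a b =>
      if g2 (b2 s z a) = b then (1 - η) * (l2:ℝ) else η))) ?_
    refine Finset.prod_le_one (fun a _ => ?_) (fun a _ => expect_score _ _ _ hη0.le)
    exact Finset.expect_nonneg fun b _ => hη0.le.trans (scn _ _ hl2')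
  have hE1 : ∀ u z, 𝔼 v, w1 v u z ≤ 1 := by
    intro u z
    refine le_trans (le_of_eq (expect_pi_prod (fun a b =>
      if g1 (b1 u.2 z a, u.1 a) = b then (1 - η) * (l1:ℝ) else η))) ?_
    refine Finset.prod_le_one (fun a _ => ?_) (fun a _ => expect_score _ _ _ hη0.le)
    exact Finset.expect_nonneg fun b _ => hη0.le.trans (scn _ _ hl1')
  have hE0 : ∀ z, 𝔼 u, 𝔼 v, w0 v u z ≤ 1 := by
    intro z
    rw [← Finset.univ_product_univ, Finset.expect_product]
    refine Finset.expect_le Finset.univ_nonempty fun u _ => ?_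
    rw [Finset.expect_comm]
    refine Finset.expect_le Finset.univ_nonempty fun v _ => ?_
    have h1 : 𝔼 s : Fin n × Fin p × Fin J → Fin M, w0 v (u, s) z
        = 𝔼 x : Fin n × Fin p × Fin J → Fin M, ∏ b, (η + (1 - η) * C x z b) :=
      Fintype.expect_equiv (Equiv.addLeft (fun i => f (v i.2, u i.2) i.1)) _ _ fun s => by
        have hφ : (Equiv.addLeft (fun i : Fin n × Fin p × Fin J => f (v i.2, u i.2) i.1)) s
          = φ v (u, s) := funext fun i => rfl
        rw [hφ]
    rw [h1]
    refine le_trans (le_of_eq (expect_blocks (fun b x =>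
      η + (1 - η) * cnt σ1 f' g' x (fun t => z (b.1, t, b.2))))) ?_
    refine le_of_eq (Finset.prod_eq_one fun b _ => ?_)
    rw [Finset.expect_add_distrib, Fintype.expect_const, ← Finset.mul_expect, expect_cnt]
    ring
  have D2 : 𝔼 u, 𝔼 v, ∑ z, P v u z *
      (if w2 u z.2 < (2:ℝ) ^ ((((n * p * J : ℕ)) : ℝ) * t2) then (1:ℝ) else 0) ≤ εA / ρ := by
    have h := avg_comb (A := Fin p × Fin J) (S := Fin n × Fin p × Fin J → Fin M)
      (fun (i : Fin l1) (j : Fin l2) => ∑ z : Fin n → Y2, (∏ t, margW2 W (f (i, j) t) (z t)) *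
        (if g2 z = j then (0:ℝ) else 1)) ρ
    have h' := (errA2 W hW n l1 l2 f g1 g2).trans hA
    refine le_trans ?_ (h.le.trans (by gcongr))
    refine Finset.expect_le_expect fun u _ => Finset.expect_le_expect fun v _ => ?_
    refine thr_sum (P v u) (hP0 v u) _ (fun a z => if g2 (b2 u.2 z.2 a) = u.1 a then (0:ℝ) else 1)
      _ (by positivity) (fun z => ?_) _ (fun a => ?_)
    · rw [← hN1]
      refine le_trans (score_threshold (fun a => if g2 (b2 u.2 z.2 a) = u.1 a then
        (1 - η) * (l2:ℝ) else η) (fun a => ¬ g2 (b2 u.2 z.2 a) = u.1 a) l2 n η ((1-η)^2) ρ t2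
        hη0 hl2' hlamη hlam1 hρ0 (fun a => scn _ _ hl2') (fun a ha => ?_) ht2) (le_of_eq ?_)
      · rw [if_pos (not_not.mp ha)]; gcongr
      · congr 1
        refine Finset.sum_congr rfl fun a _ => ?_
        by_cases hh : g2 (b2 u.2 z.2 a) = u.1 a
        · rw [if_neg (not_not.mpr hh)]; exact (if_pos hh).symm
        · rw [if_pos hh]; exact (if_neg hh).symm
    · refine le_of_eq ((nFoldI_marg2 W hW (φ v u) (fun t => (t, a))
        (fun t t' h => (Prod.mk.inj h).1) (fun y => if g2 (fun t => (σ2 (u.2 (t,a))).symm (y t))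
          = u.1 a then (0:ℝ) else 1)).trans ?_)
      exact unshift_sum (margW2 W) σ2 hσ2 (f (v a, u.1 a)) (fun t => u.2 (t, a))
        (fun y => if g2 y = u.1 a then (0:ℝ) else 1)
  have D1 : 𝔼 u, 𝔼 v, ∑ z, P v u z *
      (if w1 v u z.1 < (2:ℝ) ^ ((((n * p * J : ℕ)) : ℝ) * t1) then (1:ℝ) else 0) ≤ εA / ρ := by
    have h := avg_comb (A := Fin p × Fin J) (S := Fin n × Fin p × Fin J → Fin M)
      (fun (i : Fin l1) (j : Fin l2) => ∑ z : Fin n → Y1, (∏ t, margW1 W (f (i, j) t) (z t)) *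
        (if g1 (z, j) = i then (0:ℝ) else 1)) ρ
    have h' := (errA1 W hW n l1 l2 f g1 g2).trans hA
    refine le_trans ?_ (h.le.trans (by gcongr))
    refine Finset.expect_le_expect fun u _ => Finset.expect_le_expect fun v _ => ?_
    refine thr_sum (P v u) (hP0 v u) _
      (fun a z => if g1 (b1 u.2 z.1 a, u.1 a) = v a then (0:ℝ) else 1)
      _ (by positivity) (fun z => ?_) _ (fun a => ?_)
    · rw [← hN1]
      refine le_trans (score_threshold (fun a => if g1 (b1 u.2 z.1 a, u.1 a) = v a then
        (1 - η) * (l1:ℝ) else η) (fun a => ¬ g1 (b1 u.2 z.1 a, u.1 a) = v a) l1 n η ((1-η)^2) ρ t1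
        hη0 hl1' hlamη hlam1 hρ0 (fun a => scn _ _ hl1') (fun a ha => ?_) ht1) (le_of_eq ?_)
      · rw [if_pos (not_not.mp ha)]; gcongr
      · congr 1
        refine Finset.sum_congr rfl fun a _ => ?_
        by_cases hh : g1 (b1 u.2 z.1 a, u.1 a) = v a
        · rw [if_neg (not_not.mpr hh)]; exact (if_pos hh).symm
        · rw [if_pos hh]; exact (if_neg hh).symm
    · refine le_of_eq ((nFoldI_marg1 W hW (φ v u) (fun t => (t, a))
        (fun t t' h => (Prod.mk.inj h).1)
        (fun y => if g1 (fun t => (σ1 (u.2 (t,a))).symm (y t), u.1 a)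
          = v a then (0:ℝ) else 1)).trans ?_)
      exact unshift_sum (margW1 W) σ1 hσ1 (f (v a, u.1 a)) (fun t => u.2 (t, a))
        (fun y => if g1 (y, u.1 a) = v a then (0:ℝ) else 1)
  have D0 : 𝔼 u, 𝔼 v, ∑ z, P v u z *
      (if w0 v u z.1 < (2:ℝ) ^ ((((n * p * J : ℕ)) : ℝ) * t0) then (1:ℝ) else 0)
        ≤ εB / (η * ρ) := by
    refine Finset.expect_le Finset.univ_nonempty fun u _ =>
      Finset.expect_le Finset.univ_nonempty fun v _ => ?_
    have hc : (0:ℝ) < Fintype.card (Fin n × Fin J) := by exact_mod_cast Fintype.card_pos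
    refine le_trans (thr_sum (P v u) (hP0 v u) _
      (fun b z => ((k:ℝ) - C (φ v u) z.1 b) / (η * k))
      (ρ * Fintype.card (Fin n × Fin J)) (by positivity) (fun z => ?_) (fun _ => εB / η)
        (fun b => ?_)) (le_of_eq ?_)
    · rw [← hN0]
      refine le_trans (score_threshold (fun b => η + (1 - η) * C (φ v u) z.1 b)
        (fun b => C (φ v u) z.1 b < (1 - η) * k) k p η ((1-η)^2) ρ t0
        hη0 hk' hlamη hlam1 hρ0 (fun b => hCη _ _ _) (fun b hb => ?_) ht0) ?_
      · push Not at hb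
        nlinarith
      · gcongr with b _
        have hle : C (φ v u) z.1 b ≤ k := by
          have h1 := cnt_compl σ1 f' g' (fun t => φ v u (b.1, t, b.2)) (fun t => z.1 (b.1, t, b.2))
          have h2 : (0:ℝ) ≤ ∑ m, if g' (fun t => σ1 (f' m t - φ v u (b.1, t, b.2))
              (z.1 (b.1, t, b.2))) = m then (0:ℝ) else 1 :=
            Finset.sum_nonneg fun m _ => by split_ifs <;> norm_num
          have h3 : (0:ℝ) ≤ k - C (φ v u) z.1 b := h2.trans_eq h1.symm
          linarith
        split_ifs with hb
        · rw [le_div_iff₀ (by positivity)]; linarith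
        · exact div_nonneg (by linarith) (by positivity)
    · have h1 := nFoldI_marg1 W hW (φ v u) (fun t : Fin p => (b.1, t, b.2))
        (fun t t' h => (Prod.mk.inj (Prod.mk.inj h).2).1)
        (fun y => (k:ℝ) - cnt σ1 f' g' (fun t => φ v u (b.1, t, b.2)) y)
      have h2 := cnt_err (margW1 W) σ1 hσ1 f' g' (fun t => φ v u (b.1, t, b.2))
      have h3 : ∑ z, P v u z * ((k:ℝ) - C (φ v u) z.1 b) ≤ k * εB :=
        (h1.trans h2).le.trans hB
      simp only [mul_div_assoc', ← Finset.sum_div]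
      rw [div_le_div_iff₀ (by positivity) hη0]
      nlinarith
    · rw [Finset.sum_const, Finset.card_univ, nsmul_eq_mul]
      field_simp
  obtain ⟨c2, c1, G1, G2, h⟩ := superposition P hP0 hP1 w2 w1 w0
    (fun u z => Finset.prod_nonneg fun a _ => hη0.le.trans (scn _ _ hl2'))
    (fun v u z => Finset.prod_nonneg fun a _ => hη0.le.trans (scn _ _ hl1'))
    (fun v u z => Finset.prod_nonneg fun b _ => hη0.le.trans (hCη _ _ _))
    hE2 hE1 hE0 ((2:ℝ) ^ ((((n * p * J : ℕ)) : ℝ) * t2)) ((2:ℝ) ^ ((((n * p * J : ℕ)) : ℝ) * t1))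
    ((2:ℝ) ^ ((((n * p * J : ℕ)) : ℝ) * t0)) (by positivity) (by positivity) (by positivity)
    (εA / ρ + εA / ρ + εB / (η * ρ)) (by
      simp only [mul_add, Finset.sum_add_distrib, Finset.expect_add_distrib]
      exact add_le_add (add_le_add D2 D1) D0) K1 K2 hK1 hK2
  exact ⟨fun m => φ (c1 m) (c2 m.2), G1, G2, h⟩

/-! ### Transport to blocklength indices -/

theorem errP0_of_index {X Y1 Y2 ι : Type} [Fintype Y1] [Fintype Y2] [Fintype ι] [DecidableEq ι]
    (W : X → Y1 × Y2 → ℝ) (N : ℕ) (e : ι ≃ Fin N) (K1 K2 : ℕ)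
    (F : Fin K1 × Fin K2 → ι → X) (G1 : (ι → Y1) → Fin K1) (G2 : (ι → Y2) → Fin K2) :
    errP0 W N K1 K2 (fun m t => F m (e.symm t)) (fun y => G1 (fun i => y (e i)))
      (fun y => G2 (fun i => y (e i)))
      = (1 : ℝ) / ((K1 : ℝ) * (K2 : ℝ)) * ∑ m : Fin K1 × Fin K2, ∑ y,
        nFoldI W (F m) y * (if G1 y.1 = m.1 ∧ G2 y.2 = m.2 then 0 else 1) := by
  unfold errP0
  congr 1
  refine Finset.sum_congr rfl fun m _ => ?_
  symm
  refine Fintype.sum_equiv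
    ((e.arrowCongr (Equiv.refl Y1)).prodCongr (e.arrowCongr (Equiv.refl Y2))) _ _ fun y => ?_
  have h1 : nFold W N (fun t => F m (e.symm t))
      (((e.arrowCongr (Equiv.refl Y1)).prodCongr (e.arrowCongr (Equiv.refl Y2))) y)
      = nFoldI W (F m) y := by
    unfold nFold nFoldI
    rw [← e.prod_comp]
    simp [Equiv.arrowCongr]
  rw [h1]
  congr 1
  simp [Equiv.arrowCongr]

theorem exists_le_of_expect {k : ℕ} (hk : 0 < k) (h : Fin k → ℝ) (ε : ℝ) (hε : 𝔼 j, h j ≤ ε) :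
    ∃ j, h j ≤ ε := by
  have : NeZero k := ⟨hk.ne'⟩
  by_contra hcon
  push Not at hcon
  have h1 : ε < 𝔼 j, h j := by
    rw [Fintype.expect_eq_sum_div_card, Fintype.card_fin, lt_div_iff₀ (by exact_mod_cast hk)]
    have : ∑ j : Fin k, ε < ∑ j, h j :=
      Finset.sum_lt_sum_of_nonempty Finset.univ_nonempty fun j _ => hcon j
    simp at this
    linarith
  linarith

theorem single_code {X Y1 Y2 : Type} [Fintype Y1] [Fintype Y2]
    (W : X → Y1 × Y2 → ℝ) (hW : IsChannel W) (R : ℝ × ℝ) (h : Ach1 W R) (ε : ℝ) (hε : 0 < ε) :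
    ∃ (p k : ℕ) (f' : Fin k → Fin p → X) (g' : (Fin p → Y1) → Fin k), 0 < p ∧ 0 < k ∧
      R.1 ≤ Real.logb 2 (k:ℝ) / (p:ℝ) ∧
      ∑ m, ∑ z : Fin p → Y1, (∏ t, margW1 W (f' m t) (z t)) * (if g' z = m then 0 else 1)
        ≤ k * ε := by
  obtain ⟨_, _, h⟩ := h
  obtain ⟨n, k1, k2, hn, hk1, hk2, f, g1, g2, hr1, _, he⟩ := h ε hε
  obtain ⟨j, hj⟩ := exists_le_of_expect hk2 _ ε ((errA1 W hW n k1 k2 f g1 g2).trans he)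
  refine ⟨n, k1, fun i => f (i, j), fun z => g1 (z, j), hn, hk1, hr1, ?_⟩
  rw [Fintype.expect_eq_sum_div_card, Fintype.card_fin, div_le_iff₀ (by exact_mod_cast hk1)] at hj
  linarith

theorem rate_cond (n : ℕ) (hn : 0 < n) (a L A t g ρ x y : ℝ) (hL : a ≤ L / n)
    (haA : a ≤ A) (ht : t + g ≤ a) (hρ0 : 0 ≤ ρ) (hρ1 : ρ ≤ 1)
    (hx : x + ρ * y ≤ 0) (hD : ρ * A - (x + ρ * y) ≤ g) :
    (n:ℝ) * t ≤ (1 - ρ) * L + x + ρ * y := by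
  have hn' : (1:ℝ) ≤ n := by exact_mod_cast hn
  rw [le_div_iff₀ (by linarith)] at hL
  have h1 : (1 - ρ) * (a * n) ≤ (1 - ρ) * L := mul_le_mul_of_nonneg_left hL (by linarith)
  have h2 : ρ * a ≤ ρ * A := mul_le_mul_of_nonneg_left haA hρ0
  have h3 : 0 ≤ n * ((1 - ρ) * a - t + (x + ρ * y)) :=
    mul_nonneg (by linarith) (by nlinarith)
  nlinarith

theorem ceil_bounds (r : ℝ) (hr : 0 ≤ r) : 0 < ⌈(2:ℝ) ^ r⌉₊ ∧ r ≤ Real.logb 2 (⌈(2:ℝ) ^ r⌉₊ : ℝ) ∧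
    (⌈(2:ℝ) ^ r⌉₊ : ℝ) ≤ 2 * 2 ^ r := by
  have h0 : (0:ℝ) < 2 ^ r := by positivity
  have h1 : (1:ℝ) ≤ 2 ^ r := Real.one_le_rpow (by norm_num) hr
  have h2 := Nat.le_ceil ((2:ℝ) ^ r)
  have h3 := Nat.ceil_lt_add_one h0.le
  refine ⟨Nat.ceil_pos.mpr h0, ?_, by linarith⟩
  rw [Real.le_logb_iff_rpow_le (by norm_num) (by linarith)]
  exact h2

set_option maxHeartbeats 1000000 in
theorem main_ach {M : ℕ} [NeZero M] {Y1 Y2 : Type} [Fintype Y1] [Fintype Y2]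
    (W : Fin M → Y1 × Y2 → ℝ) (hW : IsChannel W)
    (hcs1 : CircSym (margW1 W)) (hcs2 : CircSym (margW2 W))
    (a b r : ℝ × ℝ) (ha : Ach1 W a) (hr : Ach1 W r) (hb1 : 0 ≤ b.1) (hb2 : 0 ≤ b.2)
    (hba1 : b.1 < a.1) (hba2 : b.2 < a.2) (hbr : b.1 + b.2 < r.1) : Ach0 W b := by
  refine ⟨hb1, hb2, fun ε hε => ?_⟩
  obtain ⟨σ1, hσ1⟩ := circSym_shift _ hcs1
  obtain ⟨σ2, hσ2⟩ := circSym_shift _ hcs2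
  obtain ⟨g, hg0, hg1, hg2, hg3⟩ : ∃ g : ℝ, 0 < g ∧ b.1 + g + g ≤ a.1 ∧ b.2 + g + g ≤ a.2 ∧
      b.1 + b.2 + g + g ≤ r.1 := by
    refine ⟨min (a.1 - b.1) (min (a.2 - b.2) (r.1 - (b.1 + b.2))) / 2, ?_, ?_, ?_, ?_⟩
    · have : 0 < min (a.1 - b.1) (min (a.2 - b.2) (r.1 - (b.1 + b.2))) :=
        lt_min (by linarith) (lt_min (by linarith) (by linarith))
      linarith
    · have := min_le_left (a.1 - b.1) (min (a.2 - b.2) (r.1 - (b.1 + b.2)))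
      linarith
    · have := (min_le_right (a.1 - b.1) (min (a.2 - b.2) (r.1 - (b.1 + b.2)))).trans
        (min_le_left _ _)
      linarith
    · have := (min_le_right (a.1 - b.1) (min (a.2 - b.2) (r.1 - (b.1 + b.2)))).trans
        (min_le_right _ _)
      linarith
  obtain ⟨η, hη0, hη1, hη⟩ : ∃ η : ℝ, 0 < η ∧ η ≤ 1/4 ∧ -(g / 3) ≤ Real.logb 2 ((1 - η)^2) := by
    have hc : ContinuousAt (fun η : ℝ => Real.log ((1 - η)^2) / Real.log 2) 0 :=
      ContinuousAt.div_const (ContinuousAt.log (by fun_prop) (by norm_num)) _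
    have h1 : ∀ᶠ η in nhds (0:ℝ), -(g/3) < Real.log ((1 - η)^2) / Real.log 2 :=
      hc.eventually (lt_mem_nhds (by simp; linarith))
    have h2 : ∀ᶠ η in nhds (0:ℝ), η < 1/4 := gt_mem_nhds (by norm_num)
    obtain ⟨η, ⟨h3, h4⟩, h5⟩ := (((h1.and h2).filter_mono nhdsWithin_le_nhds).and
      (self_mem_nhdsWithin (a := (0:ℝ)) (s := Set.Ioi 0))).exists
    exact ⟨η, h5, h4.le, h3.le⟩
  have hlogη : Real.logb 2 η ≤ 0 := Real.logb_nonpos (by norm_num) hη0.le (by linarith)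
  have hlogη2 : Real.logb 2 ((1 - η)^2) ≤ 0 :=
    Real.logb_nonpos (by norm_num) (by positivity) (by nlinarith)
  have ha1 := ha.1
  have ha2 := ha.2.1
  have hr1 := hr.1
  obtain ⟨A, hA⟩ : ∃ A, A = a.1 + a.2 + r.1 := ⟨_, rfl⟩
  obtain ⟨ρ, hρ0, hρ1, hρ⟩ : ∃ ρ : ℝ, 0 < ρ ∧ ρ ≤ 1 ∧ ρ * (A - Real.logb 2 η) ≤ g / 3 := by
    have hQ : 0 < A + 1 - Real.logb 2 η := by linarith
    refine ⟨min 1 (g / 3 / (A + 1 - Real.logb 2 η)), lt_min one_pos (by positivity),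
      min_le_left _ _, ?_⟩
    calc _ ≤ (g / 3 / (A + 1 - Real.logb 2 η)) * (A + 1 - Real.logb 2 η) := by
          apply mul_le_mul (min_le_right _ _) (by linarith) (by linarith) (by positivity)
      _ = g / 3 := div_mul_cancel₀ _ hQ.ne'
  have hxy : Real.logb 2 ((1 - η)^2) + ρ * Real.logb 2 η ≤ 0 := by nlinarith
  have hD : ρ * A - (Real.logb 2 ((1 - η)^2) + ρ * Real.logb 2 η) ≤ g := by nlinarith
  obtain ⟨n, l1, l2, hn, hl1, hl2, f, g1, g2, hR1, hR2, he⟩ := ha.2.2 (ρ * (ε / 8)) (by positivity)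
  obtain ⟨p, k, f', g', hp, hk, hR0, hB⟩ := single_code W hW r hr (η * ρ * (ε / 8)) (by positivity)
  obtain ⟨J, hJ⟩ := exists_pow_lt_of_lt_one (show (0:ℝ) < ε / 32 by positivity)
    (Real.rpow_lt_one_of_one_lt_of_neg (x := 2) (z := -g) (by norm_num) (by linarith))
  have hNJ : J ≤ n * p * (J + 1) := by
    have : 1 ≤ n * p := Nat.mul_pos hn hp
    nlinarith
  obtain ⟨N, hN⟩ : ∃ N, N = n * p * (J + 1) := ⟨_, rfl⟩
  have hsmall : (2:ℝ) ^ (-((N:ℝ) * g)) ≤ ε / 32 := by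
    refine le_trans ?_ hJ.le
    rw [← Real.rpow_natCast, ← Real.rpow_mul (by norm_num)]
    apply Real.rpow_le_rpow_of_exponent_le (by norm_num)
    have : (J:ℝ) ≤ N := by rw [hN]; exact_mod_cast hNJ
    nlinarith
  obtain ⟨c11, c12, c13⟩ := ceil_bounds ((N:ℝ) * b.1) (by positivity)
  obtain ⟨c21, c22, c23⟩ := ceil_bounds ((N:ℝ) * b.2) (by positivity)
  obtain ⟨F, G1, G2, hcore⟩ := core_index W hW σ1 hσ1 σ2 hσ2 n l1 l2 hn hl1 hl2 f g1 g2 _ he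
    p k hp hk f' g' _ hB η ρ hη0 hη1 hρ0 (b.1 + b.2 + g) (b.1 + g) (b.2 + g)
    (rate_cond n hn a.1 _ A _ g ρ _ _ hR1 (by linarith) (by linarith) hρ0.le hρ1 hxy hD)
    (rate_cond n hn a.2 _ A _ g ρ _ _ hR2 (by linarith) (by linarith) hρ0.le hρ1 hxy hD)
    (rate_cond p hp r.1 _ A _ g ρ _ _ hR0 (by linarith) (by linarith) hρ0.le hρ1 hxy hD)
    (J + 1) (Nat.succ_pos _) _ _ c11 c21
  have hNpos : 0 < N := by
    rw [hN]
    exact Nat.mul_pos (Nat.mul_pos hn hp) (Nat.succ_pos _)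
  have hcard : Fintype.card (Fin n × Fin p × Fin (J + 1)) = N := by
    rw [hN]; simp [mul_assoc]
  have hN' : (0:ℝ) < N := by exact_mod_cast hNpos
  refine ⟨N, _, _, hNpos, c11, c21, _, _, _, ?_, ?_,
    (errP0_of_index W N (Fintype.equivFinOfCardEq hcard) _ _ F G1 G2).le.trans
      (hcore.trans ?_)⟩
  · rw [le_div_iff₀ hN']; linarith
  · rw [le_div_iff₀ hN']; linarith
  · rw [← hN]
    have e1 : ρ * (ε / 8) / ρ = ε / 8 := by field_simp
    have e2 : η * ρ * (ε / 8) / (η * ρ) = ε / 8 := by field_simp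
    have q : ∀ s : ℝ, (2:ℝ) ^ ((N:ℝ) * s) = 2 ^ ((N:ℝ) * (s + g)) * 2 ^ (-((N:ℝ) * g)) := by
      intro s
      rw [← Real.rpow_add (by norm_num)]
      congr 1; ring
    have z2 : (⌈(2:ℝ) ^ ((N:ℝ) * b.2)⌉₊ : ℝ) / 2 ^ ((N:ℝ) * (b.2 + g)) ≤ ε / 8 := by
      rw [div_le_iff₀ (by positivity)]
      have h0 : (0:ℝ) < 2 ^ ((N:ℝ) * (b.2 + g)) := by positivity
      have hm := mul_le_mul_of_nonneg_left hsmall h0.le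
      rw [← q b.2] at hm
      have hpos : 0 ≤ ε * 2 ^ ((N:ℝ) * (b.2 + g)) := by positivity
      linarith
    have z1 : (⌈(2:ℝ) ^ ((N:ℝ) * b.1)⌉₊ : ℝ) / 2 ^ ((N:ℝ) * (b.1 + g)) ≤ ε / 8 := by
      rw [div_le_iff₀ (by positivity)]
      have h0 : (0:ℝ) < 2 ^ ((N:ℝ) * (b.1 + g)) := by positivity
      have hm := mul_le_mul_of_nonneg_left hsmall h0.le
      rw [← q b.1] at hm
      have hpos : 0 ≤ ε * 2 ^ ((N:ℝ) * (b.1 + g)) := by positivity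
      linarith
    have z0 : (⌈(2:ℝ) ^ ((N:ℝ) * b.1)⌉₊ : ℝ) * (⌈(2:ℝ) ^ ((N:ℝ) * b.2)⌉₊ : ℝ)
        / 2 ^ ((N:ℝ) * (b.1 + b.2 + g)) ≤ ε / 8 := by
      rw [div_le_iff₀ (by positivity)]
      have h1 := q (b.1 + b.2)
      have h0 : (0:ℝ) < 2 ^ ((N:ℝ) * (b.1 + b.2 + g)) := by positivity
      have h2 : (⌈(2:ℝ) ^ ((N:ℝ) * b.1)⌉₊ : ℝ) * (⌈(2:ℝ) ^ ((N:ℝ) * b.2)⌉₊ : ℝ)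
          ≤ (2 * 2 ^ ((N:ℝ) * b.1)) * (2 * 2 ^ ((N:ℝ) * b.2)) :=
        mul_le_mul c13 c23 (by positivity) (by positivity)
      have h3 : (2 * 2 ^ ((N:ℝ) * b.1)) * (2 * 2 ^ ((N:ℝ) * b.2))
          = 4 * (2:ℝ) ^ ((N:ℝ) * (b.1 + b.2)) := by
        rw [mul_add, Real.rpow_add (by norm_num)]; ring
      have hm := mul_le_mul_of_nonneg_left hsmall h0.le
      rw [← h1] at hm
      linarith
    rw [e1, e2]
    linarith

/-! ### Degenerate rate pairs -/

section Degenerate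

variable {X Y1 Y2 : Type} [Fintype Y1] [Fintype Y2]

theorem single_code2
    (W : X → Y1 × Y2 → ℝ) (hW : IsChannel W) (R : ℝ × ℝ) (h : Ach1 W R) (ε : ℝ) (hε : 0 < ε) :
    ∃ (p k : ℕ) (f' : Fin k → Fin p → X) (g' : (Fin p → Y2) → Fin k), 0 < p ∧ 0 < k ∧
      R.2 ≤ Real.logb 2 (k:ℝ) / (p:ℝ) ∧
      ∑ m, ∑ z : Fin p → Y2, (∏ t, margW2 W (f' m t) (z t)) * (if g' z = m then 0 else 1)
        ≤ k * ε := by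
  obtain ⟨_, _, h⟩ := h
  obtain ⟨n, k1, k2, hn, hk1, hk2, f, g1, g2, _, hr2, he⟩ := h ε hε
  have h2 := (errA2 W hW n k1 k2 f g1 g2).trans he
  rw [Finset.expect_comm] at h2
  obtain ⟨i, hi⟩ := exists_le_of_expect hk1 _ ε h2
  refine ⟨n, k2, fun j => f (i, j), g2, hn, hk2, hr2, ?_⟩
  rw [Fintype.expect_eq_sum_div_card, Fintype.card_fin, div_le_iff₀ (by exact_mod_cast hk2)] at hi
  linarith

theorem ach0_fst (W : X → Y1 × Y2 → ℝ) (hW : IsChannel W) (R : ℝ × ℝ) (h : Ach1 W R) :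
    Ach0 W (R.1, 0) := by
  refine ⟨h.1, le_rfl, fun ε hε => ?_⟩
  obtain ⟨p, k, f', g', hp, hk, hr, hB⟩ := single_code W hW R h ε hε
  refine ⟨p, k, 1, hp, hk, one_pos, fun m => f' m.1, g', fun _ => 0, hr, by simp, ?_⟩
  have hk' : (0:ℝ) < k := by exact_mod_cast hk
  unfold errP0
  rw [Nat.cast_one, mul_one, one_div, inv_mul_le_iff₀ hk']
  refine le_trans (le_of_eq ?_) hB
  rw [Fintype.sum_prod_type]
  refine Finset.sum_congr rfl fun m _ => ?_
  rw [Fintype.sum_unique]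
  refine Eq.trans ?_ (nFoldI_marg1 W hW (f' m) (fun k => k) Function.injective_id
    (fun z => if g' z = m then (0:ℝ) else 1))
  refine Finset.sum_congr rfl fun y _ => ?_
  rw [nFold_eq]
  congr 1
  by_cases hy : g' y.1 = m
  · rw [if_pos ⟨hy, Subsingleton.elim _ _⟩]; exact (if_pos hy).symm
  · rw [if_neg (fun hh => hy hh.1)]; exact (if_neg hy).symm

theorem ach0_snd (W : X → Y1 × Y2 → ℝ) (hW : IsChannel W) (R : ℝ × ℝ) (h : Ach1 W R) :
    Ach0 W (0, R.2) := by
  refine ⟨le_rfl, h.2.1, fun ε hε => ?_⟩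
  obtain ⟨p, k, f', g', hp, hk, hr, hB⟩ := single_code2 W hW R h ε hε
  refine ⟨p, 1, k, hp, one_pos, hk, fun m => f' m.2, fun _ => 0, g', by simp, hr, ?_⟩
  have hk' : (0:ℝ) < k := by exact_mod_cast hk
  unfold errP0
  rw [Nat.cast_one, one_mul, one_div, inv_mul_le_iff₀ hk']
  refine le_trans (le_of_eq ?_) hB
  rw [Fintype.sum_prod_type, Fintype.sum_unique]
  refine Finset.sum_congr rfl fun m _ => ?_
  refine Eq.trans ?_ (nFoldI_marg2 W hW (f' m) (fun k => k) Function.injective_id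
    (fun z => if g' z = m then (0:ℝ) else 1))
  refine Finset.sum_congr rfl fun y _ => ?_
  rw [nFold_eq]
  congr 1
  by_cases hy : g' y.2 = m
  · rw [if_pos ⟨Subsingleton.elim _ _, hy⟩]; exact (if_pos hy).symm
  · rw [if_neg (fun hh => hy hh.2)]; exact (if_neg hy).symm

theorem cap1_nonneg (W : X → Y1 × Y2 → ℝ) (R : ℝ × ℝ) (h : R ∈ Cap1 W) : 0 ≤ R.1 ∧ 0 ≤ R.2 := by
  have hc : IsClosed {R : ℝ × ℝ | 0 ≤ R.1 ∧ 0 ≤ R.2} :=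
    (isClosed_le continuous_const continuous_fst).inter
      (isClosed_le continuous_const continuous_snd)
  have hs : {R | Ach1 W R} ⊆ {R : ℝ × ℝ | 0 ≤ R.1 ∧ 0 ≤ R.2} := fun R hR => ⟨hR.1, hR.2.1⟩
  exact closure_minimal hs hc h

end Degenerate

theorem cap_key {M : ℕ} [NeZero M] {Y1 Y2 : Type} [Fintype Y1] [Fintype Y2]
    (W : Fin M → Y1 × Y2 → ℝ) (hW : IsChannel W)
    (hcs1 : CircSym (margW1 W)) (hcs2 : CircSym (margW2 W))
    (r c : ℝ × ℝ) (hr : r ∈ Cap1 W) (hc : c ∈ Cap1 W) (hs : r.1 + r.2 ≤ c.1) : r ∈ Cap W := by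
  obtain ⟨h1, h2⟩ := cap1_nonneg W r hr
  rw [Cap1, Metric.mem_closure_iff] at hr hc
  rw [Cap, Metric.mem_closure_iff]
  intro δ hδ
  rcases h1.eq_or_lt with h1 | h1
  · obtain ⟨a, ha, hd⟩ := hr δ hδ
    refine ⟨(0, a.2), ach0_snd W hW a ha, ?_⟩
    rw [Prod.dist_eq] at hd ⊢
    rw [max_lt_iff] at hd ⊢
    refine ⟨?_, hd.2⟩
    rw [← h1, dist_self]; exact hδ
  rcases h2.eq_or_lt with h2 | h2
  · obtain ⟨a, ha, hd⟩ := hr δ hδ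
    refine ⟨(a.1, 0), ach0_fst W hW a ha, ?_⟩
    rw [Prod.dist_eq] at hd ⊢
    rw [max_lt_iff] at hd ⊢
    refine ⟨hd.1, ?_⟩
    rw [← h2, dist_self]; exact hδ
  obtain ⟨e, he0, he1, he2, he3⟩ : ∃ e : ℝ, 0 < e ∧ 2 * e < δ ∧ 2 * e < r.1 ∧ 2 * e < r.2 := by
    have hm : 0 < min δ (min r.1 r.2) := lt_min hδ (lt_min h1 h2)
    have m1 := min_le_left δ (min r.1 r.2)
    have m2 := min_le_right δ (min r.1 r.2)
    have m3 := min_le_left r.1 r.2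
    have m4 := min_le_right r.1 r.2
    exact ⟨min δ (min r.1 r.2) / 4, by linarith, by linarith, by linarith, by linarith⟩
  obtain ⟨a, ha, hda⟩ := hr e he0
  obtain ⟨q, hq, hdq⟩ := hc e he0
  rw [Prod.dist_eq, max_lt_iff, Real.dist_eq, Real.dist_eq, abs_lt, abs_lt] at hda hdq
  refine ⟨(r.1 - 2 * e, r.2 - 2 * e), main_ach W hW hcs1 hcs2 a _ q ha hq ?_ ?_ ?_ ?_ ?_, ?_⟩
  · simp only; linarith
  · simp only; linarith
  · simp only; linarith [hda.1.2]
  · simp only; linarith [hda.2.2]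
  · simp only; linarith [hdq.1.2]
  · rw [Prod.dist_eq, max_lt_iff, Real.dist_eq, Real.dist_eq, abs_lt, abs_lt]
    refine ⟨⟨?_, ?_⟩, ⟨?_, ?_⟩⟩ <;> simp only <;> linarith

/-! ### Exchanging the receivers -/

section Swap

variable {X Y1 Y2 : Type} [Fintype Y1] [Fintype Y2]

/-- The broadcast channel with exchanged receivers. -/
def swapW (W : X → Y1 × Y2 → ℝ) : X → Y2 × Y1 → ℝ := fun x y => W x (y.2, y.1)

theorem swapW_channel (W : X → Y1 × Y2 → ℝ) (hW : IsChannel W) : IsChannel (swapW W) := by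
  intro x
  refine ⟨fun y => (hW x).1 _, ?_⟩
  rw [← (hW x).2]
  exact Fintype.sum_equiv (Equiv.prodComm Y2 Y1) _ _ fun y => rfl

theorem ach1_swap (W : X → Y1 × Y2 → ℝ) (R : ℝ × ℝ) (h : Ach2 W R) :
    Ach1 (swapW W) R.swap := by
  obtain ⟨h1, h2, h⟩ := h
  refine ⟨h2, h1, fun ε hε => ?_⟩
  obtain ⟨n, k1, k2, hn, hk1, hk2, f, g1, g2, hr1, hr2, he⟩ := h ε hε
  refine ⟨n, k2, k1, hn, hk2, hk1, fun m => f m.swap, g2, g1, hr2, hr1, le_trans (le_of_eq ?_) he⟩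
  unfold errP1 errP2
  rw [mul_comm (k2:ℝ)]
  congr 1
  refine Fintype.sum_equiv (Equiv.prodComm _ _) _ _ fun m => ?_
  refine Fintype.sum_equiv (Equiv.prodComm _ _) _ _ fun y => ?_
  refine congrArg₂ (· * ·) rfl ?_
  exact if_congr and_comm rfl rfl

theorem ach0_swap (W : X → Y1 × Y2 → ℝ) (R : ℝ × ℝ) (h : Ach0 (swapW W) R) :
    Ach0 W R.swap := by
  obtain ⟨h1, h2, h⟩ := h
  refine ⟨h2, h1, fun ε hε => ?_⟩
  obtain ⟨n, k1, k2, hn, hk1, hk2, f, g1, g2, hr1, hr2, he⟩ := h ε hε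
  refine ⟨n, k2, k1, hn, hk2, hk1, fun m => f m.swap, g2, g1, hr2, hr1, le_trans (le_of_eq ?_) he⟩
  unfold errP0
  rw [mul_comm (k2:ℝ)]
  congr 1
  refine Fintype.sum_equiv (Equiv.prodComm _ _) _ _ fun m => ?_
  refine Fintype.sum_equiv (Equiv.prodComm _ _) _ _ fun y => ?_
  refine congrArg₂ (· * ·) rfl ?_
  exact if_congr and_comm rfl rfl

theorem ach0_ach1 (W : X → Y1 × Y2 → ℝ) (R : ℝ × ℝ) (h : Ach0 W R) : Ach1 W R := by
  obtain ⟨h1, h2, h⟩ := h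
  refine ⟨h1, h2, fun ε hε => ?_⟩
  obtain ⟨n, k1, k2, hn, hk1, hk2, f, g1, g2, hr1, hr2, he⟩ := h ε hε
  exact ⟨n, k1, k2, hn, hk1, hk2, f, fun y => g1 y.1, g2, hr1, hr2, he⟩

theorem ach0_ach2 (W : X → Y1 × Y2 → ℝ) (R : ℝ × ℝ) (h : Ach0 W R) : Ach2 W R := by
  obtain ⟨h1, h2, h⟩ := h
  refine ⟨h1, h2, fun ε hε => ?_⟩
  obtain ⟨n, k1, k2, hn, hk1, hk2, f, g1, g2, hr1, hr2, he⟩ := h ε hε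
  exact ⟨n, k1, k2, hn, hk1, hk2, f, g1, fun y => g2 y.1, hr1, hr2, he⟩

end Swap

theorem cap_key2 {M : ℕ} [NeZero M] {Y1 Y2 : Type} [Fintype Y1] [Fintype Y2]
    (W : Fin M → Y1 × Y2 → ℝ) (hW : IsChannel W)
    (hcs1 : CircSym (margW1 W)) (hcs2 : CircSym (margW2 W))
    (r c : ℝ × ℝ) (hr : r ∈ Cap2 W) (hc : c ∈ Cap2 W) (hs : r.1 + r.2 ≤ c.2) : r ∈ Cap W := by
  have hsw : ∀ r, r ∈ Cap2 W → r.swap ∈ Cap1 (swapW W) := fun r hr =>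
    map_mem_closure continuous_swap hr fun R hR => ach1_swap W R hR
  have h := cap_key (swapW W) (swapW_channel W hW) hcs2 hcs1 r.swap c.swap (hsw r hr) (hsw c hc)
    (by simp only [Prod.fst_swap, Prod.snd_swap]; linarith)
  have h' : r.swap.swap ∈ Cap W :=
    map_mem_closure continuous_swap h fun R hR => ach0_swap W R hR
  rwa [Prod.swap_swap] at h'

/-! ### The binary symmetric broadcast channel region -/

theorem Hb_eq (x : ℝ) : Hb x = Real.binEntropy x / Real.log 2 := by
  unfold Hb
  rw [Real.binEntropy_eq_negMulLog_add_negMulLog_one_sub]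
  simp only [Real.negMulLog, Real.logb]
  ring

theorem Hb_half : Hb (1/2) = 1 := by
  rw [Hb_eq, one_div, Real.binEntropy_two_inv, div_self (Real.log_pos (by norm_num)).ne']

theorem Hb_mono {x y : ℝ} (h0 : 0 ≤ x) (hxy : x ≤ y) (hy : y ≤ 1/2) : Hb x ≤ Hb y := by
  rw [Hb_eq, Hb_eq]
  have := Real.binEntropy_strictMonoOn.monotoneOn (a := x) (b := y)
    ⟨h0, by norm_num at hy ⊢; linarith⟩ ⟨by linarith, by norm_num at hy ⊢; linarith⟩ hxy
  exact div_le_div_of_nonneg_right this (Real.log_pos (by norm_num)).le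

theorem Hb_lt_one {x : ℝ} (hy : x < 1/2) : Hb x < 1 := by
  rw [Hb_eq, div_lt_one (Real.log_pos (by norm_num)), Real.binEntropy_lt_log_two]
  norm_num at hy ⊢
  exact hy.ne

theorem concave_exchange {f : ℝ → ℝ} {s : Set ℝ} (hf : ConcaveOn ℝ s f) {w y u v : ℝ}
    (hw : w ∈ s) (hv : v ∈ s) (hwy : w ≤ y) (hyv : y ≤ v) (hsum : w + v = y + u) :
    f w + f v ≤ f y + f u := by
  rcases (hwy.trans hyv).eq_or_lt with h | h
  · have h1 : y = w := by linarith
    have h2 : u = v := by linarith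
    rw [h1, h2]
  · have hd : 0 < v - w := by linarith
    have ha : 0 ≤ (v - y) / (v - w) := div_nonneg (by linarith) hd.le
    have hb : 0 ≤ (y - w) / (v - w) := div_nonneg (by linarith) hd.le
    have hab : (v - y) / (v - w) + (y - w) / (v - w) = 1 := by
      rw [← add_div, div_eq_one_iff_eq hd.ne']; ring
    have e1 := hf.2 hw hv ha hb hab
    have e2 := hf.2 hw hv hb ha (by rw [add_comm]; exact hab)
    simp only [smul_eq_mul] at e1 e2
    have q1 : (v - y) / (v - w) * w + (y - w) / (v - w) * v = y := by
      field_simp; ring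
    have q2 : (y - w) / (v - w) * w + (v - y) / (v - w) * v = u := by
      have : u = w + v - y := by linarith
      rw [this]; field_simp; ring
    rw [q1] at e1
    rw [q2] at e2
    calc f w + f v = ((v - y) / (v - w) + (y - w) / (v - w)) * (f w + f v) := by
          rw [hab, one_mul]
      _ ≤ f y + f u := by linarith

theorem Hb_slope {x y u v : ℝ} (h0 : 0 ≤ x) (hyv : y ≤ v) (huv : u ≤ v)
    (hv : v ≤ 1/2) (hd : v - u ≤ y - x) : Hb v - Hb y ≤ Hb u - Hb x := by
  have h1 : Hb x ≤ Hb (y - (v - u)) := Hb_mono h0 (by linarith) (by linarith)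
  have h2 := concave_exchange Real.strictConcave_binEntropy.concaveOn (w := y - (v - u)) (y := y)
    (u := u) (v := v) ⟨by linarith, by linarith⟩ ⟨by linarith, by linarith⟩ (by linarith)
    hyv (by ring)
  have h3 : Hb (y - (v - u)) + Hb v ≤ Hb y + Hb u := by
    simp only [Hb_eq, ← add_div]
    exact div_le_div_of_nonneg_right h2 (Real.log_pos (by norm_num)).le
  linarith

theorem cbsbc_sum1 {d1 d2 : ℝ} (h0 : 0 ≤ d1) (h12 : d1 ≤ d2) (h2 : d2 < 1/2) (R : ℝ × ℝ)
    (hR : R ∈ CBSBC d1 d2) : R.1 + R.2 ≤ 1 - Hb d1 := by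
  obtain ⟨_, _, α, ⟨ha0, ha1⟩, hR1, hR2⟩ := hR
  have := Hb_mono (x := bconv α d1) (y := bconv α d2) (by unfold bconv; nlinarith)
    (by unfold bconv; nlinarith) (by unfold bconv; nlinarith)
  linarith

theorem cbsbc_sum2 {d1 d2 : ℝ} (h0 : 0 ≤ d2) (h12 : d2 ≤ d1) (h2 : d1 < 1/2) (R : ℝ × ℝ)
    (hR : R ∈ CBSBC d1 d2) : R.1 + R.2 ≤ 1 - Hb d2 := by
  obtain ⟨_, _, α, ⟨ha0, ha1⟩, hR1, hR2⟩ := hR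
  have := Hb_slope (x := d2) (y := d1) (u := bconv α d2) (v := bconv α d1) h0
    (by unfold bconv; nlinarith) (by unfold bconv; nlinarith) (by unfold bconv; nlinarith)
    (by unfold bconv; nlinarith)
  linarith

theorem cbsbc_mem1 {d1 d2 : ℝ} (h1 : d1 < 1/2) : (1 - Hb d1, (0:ℝ)) ∈ CBSBC d1 d2 := by
  have hb : ∀ d, bconv (1/2) d = 1/2 := fun d => by unfold bconv; ring
  refine ⟨by simp only; linarith [Hb_lt_one h1], le_rfl, 1/2, ⟨by norm_num, le_rfl⟩, ?_, ?_⟩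
  · simp only [hb, Hb_half]; exact le_rfl
  · simp only [hb, Hb_half]; norm_num

theorem cbsbc_mem2 {d1 d2 : ℝ} (h2 : d2 < 1/2) : ((0:ℝ), 1 - Hb d2) ∈ CBSBC d1 d2 := by
  have hb : ∀ d, bconv 0 d = d := fun d => by unfold bconv; ring
  refine ⟨le_rfl, by simp only; linarith [Hb_lt_one h2], 0, ⟨le_rfl, by norm_num⟩, ?_, ?_⟩
  · simp only [hb]; linarith
  · simp only [hb]; exact le_rfl

/-- **Proposition 12.** If both marginal channels are circularly symmetric, then
the optimal bandwidth-expansion bound `κ*` can be computed from the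
private-message capacity region `𝒞(p_{Y1,Y2|X})` itself. -/
theorem kappaStar_circularlySymmetric
    {M : ℕ} [NeZero M] {Y1 Y2 : Type} [Fintype Y1] [Fintype Y2]
    [Nonempty Y1] [Nonempty Y2]
    (W : Fin M → Y1 × Y2 → ℝ) (hW : IsChannel W)
    (hcs1 : CircSym (margW1 W)) (hcs2 : CircSym (margW2 W))
    (hC1 : 0 < Cmarg (margW1 W)) (hC2 : 0 < Cmarg (margW2 W))
    (d1 d2 : ℝ) (hd10 : 0 ≤ d1) (hd11 : d1 < 1/2) (hd20 : 0 ≤ d2) (hd21 : d2 < 1/2) :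
    (d1 ≤ d2 →
      sInf {κ : ℝ | 0 ≤ κ ∧ CBSBC d1 d2 ⊆ scaleSet κ (Cap1 W)}
        = sInf {κ : ℝ | 0 ≤ κ ∧ CBSBC d1 d2 ⊆ scaleSet κ (Cap W)}) ∧
    (d2 ≤ d1 →
      sInf {κ : ℝ | 0 ≤ κ ∧ CBSBC d1 d2 ⊆ scaleSet κ (Cap2 W)}
        = sInf {κ : ℝ | 0 ≤ κ ∧ CBSBC d1 d2 ⊆ scaleSet κ (Cap W)}) := by
  constructor
  · intro h
    congr 1
    ext κ
    constructor
    · rintro ⟨hκ0, hκ⟩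
      refine ⟨hκ0, ?_⟩
      obtain ⟨q, hq, hqe⟩ := hκ (cbsbc_mem1 hd11)
      have hq1 : κ * q.1 = 1 - Hb d1 := congrArg (fun R : ℝ × ℝ => R.1) hqe
      have hpos := Hb_lt_one hd11
      have hκ1 : 0 < κ := by
        rcases hκ0.eq_or_lt with h0 | h0
        · rw [← h0] at hq1; linarith
        · exact h0
      intro R hR
      obtain ⟨r, hr, hre⟩ := hκ hR
      have hs := cbsbc_sum1 hd10 h hd21 R hR
      have hR1 : κ * r.1 = R.1 := congrArg (fun R : ℝ × ℝ => R.1) hre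
      have hR2 : κ * r.2 = R.2 := congrArg (fun R : ℝ × ℝ => R.2) hre
      refine ⟨r, cap_key W hW hcs1 hcs2 r q hr hq ?_, hre⟩
      refine le_of_mul_le_mul_left ?_ hκ1
      linarith
    · rintro ⟨hκ0, hκ⟩
      refine ⟨hκ0, hκ.trans (Set.image_mono (closure_mono fun R hR => ach0_ach1 W R hR))⟩
  · intro h
    congr 1
    ext κ
    constructor
    · rintro ⟨hκ0, hκ⟩
      refine ⟨hκ0, ?_⟩
      obtain ⟨q, hq, hqe⟩ := hκ (cbsbc_mem2 hd21)
      have hq1 : κ * q.2 = 1 - Hb d2 := congrArg (fun R : ℝ × ℝ => R.2) hqe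
      have hpos := Hb_lt_one hd21
      have hκ1 : 0 < κ := by
        rcases hκ0.eq_or_lt with h0 | h0
        · rw [← h0] at hq1; linarith
        · exact h0
      intro R hR
      obtain ⟨r, hr, hre⟩ := hκ hR
      have hs := cbsbc_sum2 hd20 h hd11 R hR
      have hR1 : κ * r.1 = R.1 := congrArg (fun R : ℝ × ℝ => R.1) hre
      have hR2 : κ * r.2 = R.2 := congrArg (fun R : ℝ × ℝ => R.2) hre
      refine ⟨r, cap_key2 W hW hcs1 hcs2 r q hr hq ?_, hre⟩
      refine le_of_mul_le_mul_left ?_ hκ1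
      linarith
    · rintro ⟨hκ0, hκ⟩
      refine ⟨hκ0, hκ.trans (Set.image_mono (closure_mono fun R hR => ach0_ach2 W R hR))⟩

end
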